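/- The plat closure of an adequate 2m-braid is a trivial link with m components in ℝ³; indeed, if β = β_f for a loop f in (W_m, w₀), the one-parameter family of links L_t obtained by attaching the configuration f(t) and the standard configuration w₀ to the truncated braids β_t = ⋃_{s∈I} |∂f((1−t)s)|×{s} gives an ambient isotopy from the plat closure of β to the plat closure of the trivial 2m-braid. -/

import Mathlib

namespace SurfaceLinkPlat

attribute [local instance] Classical.propDecidable

noncomputable section

open Set Function

/-- The plane `ℝ²`. -/
abbrev Plane : Type := ℝ × ℝ
/-- `ℝ³`, viewed as `ℝ² × ℝ`. -/
abbrev Space3 : Type := Plane × ℝ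
/-- `ℝ⁴`, viewed as `ℝ² × ℝ²`. -/
abbrev Space4 : Type := Plane × Plane

def unitI : Set ℝ := Icc 0 1
/-- The square `D = I²`. -/
def Dsq : Set Plane := Icc (0:ℝ) 1 ×ˢ Icc (0:ℝ) 1
/-- The `k`-th (0-indexed) of the `n` standard marked points `Q_n` in `Int D`. -/
def qpt (n k : ℕ) : Plane := (1/2, ((k : ℝ) + 1) / ((n : ℝ) + 1))
/-- The set `Q_n` of standard marked points. -/
def Qpts (n : ℕ) : Set Plane := {p | ∃ k : Fin n, p = qpt n (k : ℕ)}
def unitDisk : Set Plane := {x | x.1 ^ 2 + x.2 ^ 2 ≤ 1}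
def unitCircle : Set Plane := {x | x.1 ^ 2 + x.2 ^ 2 = 1}
def ball3 : Set Space3 := {p | p.1.1 ^ 2 + p.1.2 ^ 2 + p.2 ^ 2 ≤ 1}
def sphere2 : Set Space3 := {p | p.1.1 ^ 2 + p.1.2 ^ 2 + p.2 ^ 2 = 1}
/-- Embedding `ℝ³ × ℝ = ℝ⁴`. -/
def emb34 (q : Space3) (t : ℝ) : Space4 := (q.1, (q.2, t))

/-- Two subsets of a space are ambient isotopic:  there is a level-preserving isotopy
of the whole space starting at the identity and carrying `F` to `F'`. -/
def AmbientIsotopic {X : Type*} [TopologicalSpace X] (F F' : Set X) : Prop :=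
  ∃ H : ℝ → X ≃ₜ X,
    Continuous (fun p : ℝ × X => H p.1 p.2) ∧
    Continuous (fun p : ℝ × X => (H p.1).symm p.2) ∧
    H 0 = Homeomorph.refl X ∧ (H 1) '' F = F'

/-- A closed (compact boundaryless) surface: every point has an open neighbourhood
homeomorphic to the plane. -/
def IsClosedSurface {X : Type*} [TopologicalSpace X] (F : Set X) : Prop :=
  IsCompact F ∧ F.Nonempty ∧
    ∀ x : ↥F, ∃ U : Set ↥F, IsOpen U ∧ x ∈ U ∧ Nonempty (↥U ≃ₜ Plane)

abbrev halfPlane : Type := ℝ × ↥(Ici (0 : ℝ))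

/-- A compact surface, possibly with boundary. -/
def IsCompactSurfaceWithBdry {X : Type*} [TopologicalSpace X] (F : Set X) : Prop :=
  IsCompact F ∧ F.Nonempty ∧
    ∀ x : ↥F, ∃ U : Set ↥F, IsOpen U ∧ x ∈ U ∧
      (Nonempty (↥U ≃ₜ Plane) ∨ Nonempty (↥U ≃ₜ halfPlane))

/-- A surface-link: a closed surface embedded in `ℝ⁴`. -/
def IsSurfaceLink (F : Set Space4) : Prop := IsClosedSurface F

/-- A standard Möbius band in `ℝ³`. -/
def mobiusModel : Set Space3 :=
  {p | ∃ θ s : ℝ, s ∈ Icc (-(1:ℝ)/2) (1/2) ∧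
    p = (((2 + s * Real.cos (θ/2)) * Real.cos θ, (2 + s * Real.cos (θ/2)) * Real.sin θ),
         s * Real.sin (θ/2))}

/-- Orientability of a surface: it contains no embedded Möbius band. -/
def IsOrientableSurface {X : Type*} [TopologicalSpace X] (F : Set X) : Prop :=
  ¬ ∃ M : Set X, M ⊆ F ∧ Nonempty (↥M ≃ₜ ↥mobiusModel)

def slice3 (A : Set Space3) (t : ℝ) : Set Plane := {x | (x, t) ∈ A}
def fiberOver (S : Set Space4) (y : Plane) : Set Plane := {x | (x, y) ∈ S}

def IsArc {X : Type*} [TopologicalSpace X] (a : Set X) : Prop := Nonempty (↥a ≃ₜ ↥unitI)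

/-- A geometric `n`-braid in `D × I`: a disjoint union of `n` arcs, each meeting every
level `Int D × {t}` in exactly one point, with ends `Q_n × {0,1}`. -/
structure IsGeomBraid (n : ℕ) (β : Set Space3) : Prop where
  sub : β ⊆ Dsq ×ˢ unitI
  levels : ∀ t ∈ unitI, slice3 β t ⊆ interior Dsq
  strands : ∃ a : Fin n → Set Space3,
    (∀ i, IsArc (a i)) ∧ (Pairwise fun i j => Disjoint (a i) (a j)) ∧
    (β = ⋃ i, a i) ∧ ∀ i, ∀ t ∈ unitI, ∃! x : Plane, (x, t) ∈ a i
  bot : slice3 β 0 = Qpts n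
  top : slice3 β 1 = Qpts n

/-- The round semicircle (wicket) in `D × I` with feet `a`, `b`, lying in the vertical
plane through `a` and `b` and meeting `D × {0}` orthogonally. -/
def wicketArc (a b : Plane) : Set Space3 :=
  {p | ∃ θ ∈ Icc (0 : ℝ) Real.pi,
    p = ((1/2 : ℝ) • (a + b) + Real.cos θ • ((1/2 : ℝ) • (a - b)),
         Real.sqrt (((a.1 - b.1)/2)^2 + ((a.2 - b.2)/2)^2) * Real.sin θ)}

/-- A configuration of `m` disjoint wickets in `D × I`. -/
def IsWicketConfig (m : ℕ) (w : Set Space3) : Prop :=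
  ∃ e : Fin m → Plane × Plane,
    (∀ i, (e i).1 ≠ (e i).2 ∧ (e i).1 ∈ interior Dsq ∧ (e i).2 ∈ interior Dsq ∧
      wicketArc (e i).1 (e i).2 ⊆ Dsq ×ˢ unitI) ∧
    (Pairwise fun i j => Disjoint (wicketArc (e i).1 (e i).2) (wicketArc (e j).1 (e j).2)) ∧
    w = ⋃ i, wicketArc (e i).1 (e i).2

/-- The standard configuration `w₀` of `m` wickets, with feet `Q_{2m}` paired consecutively. -/
def stdWickets (m : ℕ) : Set Space3 :=
  ⋃ i : Fin m, wicketArc (qpt (2*m) (2*(i:ℕ))) (qpt (2*m) (2*(i:ℕ)+1))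

/-- An adequate `2m`-braid: the associated loop in the configuration space lifts to a loop
of wicket configurations based at the standard configuration.  The continuous family of
wicket configurations is encoded by its (compact) total space `W`. -/
structure IsAdequateBraid (m : ℕ) (β : Set Space3) : Prop where
  braid : IsGeomBraid (2*m) β
  lift : ∃ W : Set (Space3 × ℝ),
    IsCompact W ∧ (∀ q ∈ W, q.2 ∈ unitI) ∧
    (∀ t ∈ unitI, IsWicketConfig m {q : Space3 | (q, t) ∈ W}) ∧
    ({q : Space3 | (q, (0:ℝ)) ∈ W} = stdWickets m) ∧
    ({q : Space3 | (q, (1:ℝ)) ∈ W} = stdWickets m) ∧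
    ∀ t ∈ unitI, ∀ x : Plane, ((x, (0:ℝ)), t) ∈ W ↔ (x, t) ∈ β

/-- The base point `y₀ ∈ ∂D₂`. -/
def y0pt : Plane := (1, 1/2)

/-- A loop running once counterclockwise around `∂D₂`, based at `y₀`. -/
def muLoop (t : ℝ) : Plane :=
  if 4 * t ≤ 1/2 then (1, 1/2 + 4*t)
  else if 4 * t ≤ 3/2 then (1 - (4*t - 1/2), 1)
  else if 4 * t ≤ 5/2 then (0, 1 - (4*t - 3/2))
  else if 4 * t ≤ 7/2 then (4*t - 5/2, 0)
  else (1, 4*t - 7/2)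

/-- The braid `β_S` traced out by the boundary fibers of a braided surface `S`. -/
def braidOf (S : Set Space4) : Set Space3 :=
  {p | p.2 ∈ unitI ∧ (p.1, muLoop p.2) ∈ S}

/-- A braided surface of degree `n` in `D₁ × D₂`: the projection to `D₂` is a simple
branched covering of degree `n`, locally trivial away from finitely many interior branch
values (where the fiber has `n-1` points, with a single 2-fold branch disk), the fiber
over `y₀` is `Q_n`, and the boundary is a closed `n`-braid in `D₁ × ∂D₂`. -/
structure IsBraidedSurface (n : ℕ) (S : Set Space4) : Prop where
  sub : S ⊆ Dsq ×ˢ Dsq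
  surf : IsCompactSurfaceWithBdry S
  branchFin : {y | y ∈ Dsq ∧ (fiberOver S y).ncard ≠ n}.Finite
  branchInt : {y | y ∈ Dsq ∧ (fiberOver S y).ncard ≠ n} ⊆ interior Dsq
  fiberCard : ∀ y ∈ Dsq, (fiberOver S y).ncard = n ∨ (fiberOver S y).ncard = n - 1
  locTriv : ∀ y ∈ Dsq, (fiberOver S y).ncard = n →
    ∃ V : Set Plane, IsOpen V ∧ y ∈ V ∧
      ∃ φ : ↥(fiberOver S y ×ˢ (V ∩ Dsq)) ≃ₜ ↥(S ∩ (univ : Set Plane) ×ˢ (V ∩ Dsq)),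
        ∀ q : ↥(fiberOver S y ×ˢ (V ∩ Dsq)), (φ q : Space4).2 = (q : Plane × Plane).2
  branchModel : ∀ y ∈ Dsq, (fiberOver S y).ncard = n - 1 →
    ∃ V : Set Plane, IsOpen V ∧ y ∈ V ∧ V ⊆ interior Dsq ∧
      ∃ B T : Set Space4, S ∩ (univ : Set Plane) ×ˢ V = B ∪ T ∧ Disjoint B T ∧
        Nonempty (↥B ≃ₜ Plane) ∧
        (∀ z ∈ V, z ≠ y → ({x | (x, z) ∈ B}).ncard = 2) ∧
        ({x | (x, y) ∈ B}).ncard = 1 ∧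
        ∃ ψ : ↥({x | (x, y) ∈ T} ×ˢ V) ≃ₜ ↥T,
          ∀ q : ↥({x | (x, y) ∈ T} ×ˢ V), (ψ q : Space4).2 = (q : Plane × Plane).2
  base : fiberOver S y0pt = Qpts n
  bdry : IsGeomBraid n (braidOf S)

/-- A 2-dimensional braid: a braided surface whose fiber over every boundary point is
the standard one. -/
def Is2DimBraid (n : ℕ) (S : Set Space4) : Prop :=
  IsBraidedSurface n S ∧ ∀ y ∈ frontier Dsq, fiberOver S y = Qpts n

def ctrPt : Plane := (1/2, 1/2)
/-- Box distance from the center of the square `D₂`; `∂D₂ = {boxDist = 1/2}`. -/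
def boxDist (y : Plane) : ℝ := max |y.1 - 1/2| |y.2 - 1/2|
/-- The point of the outer collar of `∂D₂` over `z ∈ ∂D₂` at collar height `h`. -/
def collarPt (z : Plane) (h : ℝ) : Plane := ctrPt + (1 + 2*h) • (z - ctrPt)

/-- A surface of wicket type in `D₁ × N`, where `N` is the outer collar of `∂D₂`:
over each boundary direction `z ∈ ∂D₂` its fiber is a configuration of `m` wickets,
the fiber over `y₀` being the standard configuration. -/
structure IsWicketTypeSurface (m : ℕ) (A : Set Space4) : Prop where
  sub : ∀ p ∈ A, 1/2 ≤ boxDist p.2 ∧ boxDist p.2 ≤ 3/2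
  compact : IsCompact A
  fibers : ∀ z ∈ frontier Dsq,
    IsWicketConfig m {q : Space3 | (q.1, collarPt z q.2) ∈ A ∧ 0 ≤ q.2}
  base : {q : Space3 | (q.1, collarPt y0pt q.2) ∈ A ∧ 0 ≤ q.2} = stdWickets m

/-- `F` is the plat closure of the braided surface `S` (of degree `2m`):
`F = S ∪ A` for the surface `A` of wicket type with `∂A = ∂S`. -/
def IsPlatClosureOf (m : ℕ) (S F : Set Space4) : Prop :=
  ∃ A : Set Space4, IsWicketTypeSurface m A ∧
    (∀ z ∈ frontier Dsq, {x : Plane | (x, z) ∈ A} = fiberOver S z) ∧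
    F = S ∪ A

/-- The plat index: half the minimal degree of an adequate braided surface whose plat
closure is equivalent to `F`. -/
def PlatIndex (F : Set Space4) : ℕ :=
  sInf {m : ℕ | 0 < m ∧ ∃ S F' : Set Space4, IsBraidedSurface (2*m) S ∧
    IsAdequateBraid m (braidOf S) ∧ IsPlatClosureOf m S F' ∧ AmbientIsotopic F F'}

/-- The genuine plat index: half the minimal degree of a 2-dimensional braid whose plat
closure is equivalent to `F`. -/
def GenuinePlatIndex (F : Set Space4) : ℕ :=
  sInf {m : ℕ | 0 < m ∧ ∃ S F' : Set Space4, Is2DimBraid (2*m) S ∧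
    IsPlatClosureOf m S F' ∧ AmbientIsotopic F F'}

/-- The `i`-th trivial capping disk used to close a 2-dimensional braid of degree `n`. -/
def capDisk (n : ℕ) (i : Fin n) : Set Space4 :=
  ({qpt n (i:ℕ)} ×ˢ {y | 1/2 ≤ boxDist y ∧ boxDist y ≤ ((i:ℕ):ℝ) + 2}) ∪
  {p | ∃ s ∈ unitI, p.1 = qpt n (i:ℕ) + (s * (((i:ℕ):ℝ) + 2), 0) ∧ boxDist p.2 = ((i:ℕ):ℝ) + 2} ∪
  ({qpt n (i:ℕ) + (((i:ℕ):ℝ) + 2, 0)} ×ˢ {y | boxDist y ≤ ((i:ℕ):ℝ) + 2})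

/-- The closure of a 2-dimensional braid: attach `n` trivial disks along the boundary. -/
def BraidClosure (n : ℕ) (S : Set Space4) : Set Space4 := S ∪ ⋃ i : Fin n, capDisk n i

/-- The braid index of a surface-link. -/
def BraidIndex (F : Set Space4) : ℕ :=
  sInf {n : ℕ | 0 < n ∧ ∃ S, Is2DimBraid n S ∧ AmbientIsotopic F (BraidClosure n S)}

/-- Surgery on a surface-link along one embedded 1-handle `D² × I`. -/
def OneHandleSurgery (F F' : Set Space4) : Prop :=
  ∃ φ : Space3 → Space4, Continuous φ ∧ InjOn φ (unitDisk ×ˢ unitI) ∧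
    (φ '' (unitDisk ×ˢ unitI)) ∩ F = φ '' (unitDisk ×ˢ ({0, 1} : Set ℝ)) ∧
    F' = (F \ φ '' (unitDisk ×ˢ ({0, 1} : Set ℝ))) ∪ φ '' (unitCircle ×ˢ unitI)

def NHandleSurgeries : ℕ → Set Space4 → Set Space4 → Prop
  | 0 => fun E F => E = F
  | (k+1) => fun E F => ∃ G, OneHandleSurgery E G ∧ NHandleSurgeries k G F

/-- A trivial 2-link: boundaries of disjointly embedded 3-balls. -/
def IsTrivial2Link (E : Set Space4) : Prop :=
  ∃ (k : ℕ) (φ : Fin k → Space3 → Space4), 0 < k ∧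
    (∀ i, Continuous (φ i) ∧ InjOn (φ i) ball3) ∧
    (Pairwise fun i j => Disjoint (φ i '' ball3) (φ j '' ball3)) ∧
    E = ⋃ i, φ i '' sphere2

/-- A ribbon surface-link: obtained from a trivial 2-link by 1-handle surgeries. -/
def IsRibbon (F : Set Space4) : Prop :=
  ∃ (E : Set Space4) (k : ℕ), IsTrivial2Link E ∧ NHandleSurgeries k E F

def Is2Knot (F : Set Space4) : Prop := IsClosedSurface F ∧ Nonempty (↥F ≃ₜ ↥sphere2)

/-- A trivial 2-knot: a 2-sphere bounding an embedded 3-ball. -/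
def IsTrivial2Knot (F : Set Space4) : Prop :=
  ∃ φ : Space3 → Space4, Continuous φ ∧ InjOn φ ball3 ∧ F = φ '' sphere2

/-- The standardly embedded 2-sphere in `ℝ³ ⊂ ℝ⁴`. -/
def stdSphere : Set Space4 := {P | ∃ q ∈ sphere2, P = emb34 q 0}
/-- The standardly embedded torus in `ℝ³ ⊂ ℝ⁴`. -/
def stdTorus : Set Space4 :=
  {P | ∃ θ ψ : ℝ,
    P = emb34 (((2 + Real.cos ψ) * Real.cos θ, (2 + Real.cos ψ) * Real.sin θ), Real.sin ψ) 0}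
/-- One of the two standardly embedded projective planes in `ℝ⁴` (Veronese model). -/
def PplusV : Set Space4 :=
  {P | ∃ x y z : ℝ, x^2 + y^2 + z^2 = 1 ∧ P = ((x*y, x*z), (y^2 - z^2, 2*y*z))}
/-- The mirror image of `PplusV`: the other standardly embedded projective plane. -/
def PminusV : Set Space4 :=
  {P | ∃ x y z : ℝ, x^2 + y^2 + z^2 = 1 ∧ P = ((x*y, x*z), (y^2 - z^2, -(2*y*z)))}

/-- `F` is a connected sum of the surface-links `G 0, …, G (k-1)`: split copies of the
summands joined by `k - 1` tubes. -/
def IsConnectedSumOf {k : ℕ} (F : Set Space4) (G : Fin k → Set Space4) : Prop :=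
  0 < k ∧ ∃ G' : Fin k → Set Space4,
    (∀ i, AmbientIsotopic (G i) (G' i)) ∧
    (∃ (c : Fin k → Space4) (r : Fin k → ℝ),
      (∀ i, G' i ⊆ Metric.closedBall (c i) (r i)) ∧
      Pairwise fun i j => Disjoint (Metric.closedBall (c i) (r i)) (Metric.closedBall (c j) (r j))) ∧
    NHandleSurgeries (k - 1) (⋃ i, G' i) F ∧ IsConnected F

def IsStdPiece (X : Set Space4) : Prop :=
  X = stdSphere ∨ X = stdTorus ∨ X = PplusV ∨ X = PminusV

/-- A trivial surface-knot: a connected sum of standardly embedded 2-spheres, tori and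
projective planes. -/
def IsTrivialSurfaceKnot (F : Set Space4) : Prop :=
  ∃ (k : ℕ) (G : Fin k → Set Space4), (∀ i, IsStdPiece (G i)) ∧ IsConnectedSumOf F G

/-- A trivial non-orientable surface-knot: at least one projective-plane summand occurs. -/
def IsTrivialNonorientableSurfaceKnot (F : Set Space4) : Prop :=
  ∃ (k : ℕ) (G : Fin k → Set Space4), (∀ i, IsStdPiece (G i)) ∧
    (∃ i, G i = PplusV ∨ G i = PminusV) ∧ IsConnectedSumOf F G

/-- A trivial non-orientable surface-knot with normal Euler number `0`: a connected sum
with equally many `P₊` and `P₋` summands. -/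
def IsTrivialNonorientableEulerZero (F : Set Space4) : Prop :=
  ∃ (k : ℕ) (G : Fin k → Set Space4), (∀ i, IsStdPiece (G i)) ∧
    (∃ i, G i = PplusV ∨ G i = PminusV) ∧
    ({i | G i = PplusV}.ncard = {i | G i = PminusV}.ncard) ∧ IsConnectedSumOf F G

/-- A trivial orientable surface-knot: a connected sum of standard spheres and tori. -/
def IsTrivialOrientableSurfaceKnot (F : Set Space4) : Prop :=
  ∃ (k : ℕ) (G : Fin k → Set Space4),
    (∀ i, G i = stdSphere ∨ G i = stdTorus) ∧ IsConnectedSumOf F G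

/-- `N` is a locally trivial normal 2-disk-bundle neighbourhood of `K` with projection `r`. -/
def IsNormalDiskBundle (K N : Set Space4) (r : Space4 → Space4) : Prop :=
  IsCompact N ∧ K ⊆ interior N ∧ ContinuousOn r N ∧ MapsTo r N K ∧
  (∀ x ∈ K, r x = x) ∧
  ∀ x ∈ K, ∃ V : Set Space4, IsOpen V ∧ x ∈ V ∧
    ∃ φ : ↥(N ∩ r ⁻¹' (K ∩ V)) ≃ₜ ↥((K ∩ V) ×ˢ unitDisk),
      (∀ q : ↥(N ∩ r ⁻¹' (K ∩ V)), (φ q : Space4 × Plane).1 = r (q : Space4)) ∧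
      (∀ q : ↥(N ∩ r ⁻¹' (K ∩ V)), (q : Space4) ∈ K ↔ (φ q : Space4 × Plane).2 = (0 : Plane))

/-- `K` has normal Euler number zero: its normal disk bundle admits a nowhere-zero
section (equivalently, the normal circle bundle admits a section). -/
def HasZeroNormalEuler (K : Set Space4) : Prop :=
  ∃ N r, IsNormalDiskBundle K N r ∧
    ∃ s : Space4 → Space4, ContinuousOn s K ∧ ∀ x ∈ K, s x ∈ N ∧ s x ∉ K ∧ r (s x) = x

/-- Rotation of the plane about `c` by angle `ang`. -/
def rotPt (c : Plane) (ang : ℝ) (p : Plane) : Plane :=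
  (c.1 + Real.cos ang * (p.1 - c.1) - Real.sin ang * (p.2 - c.2),
   c.2 + Real.sin ang * (p.1 - c.1) + Real.cos ang * (p.2 - c.2))

/-- The trivial `n`-braid `Q_n × I`. -/
def trivBraid (n : ℕ) : Set Space3 := {p | ∃ k : Fin n, p.1 = qpt n (k:ℕ) ∧ p.2 ∈ unitI}

/-- The `n`-braid `σ_k^e` (`k` 1-indexed): strands `k, k+1` rotate about their midpoint
through total angle `eπ`, the others are vertical. -/
def twistBraid (n k : ℕ) (e : ℤ) : Set Space3 :=
  {p | ∃ t ∈ unitI,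
    ((∃ j : Fin n, (j:ℕ) ≠ k - 1 ∧ (j:ℕ) ≠ k ∧ p = (qpt n (j:ℕ), t)) ∨
     p = (rotPt ((1/2 : ℝ) • (qpt n (k-1) + qpt n k)) ((e:ℝ) * Real.pi * t) (qpt n (k-1)), t) ∨
     p = (rotPt ((1/2 : ℝ) • (qpt n (k-1) + qpt n k)) ((e:ℝ) * Real.pi * t) (qpt n k), t))}

/-- The standard generator `σ_k` (or its inverse) as a geometric braid. -/
def sigmaBraid (n k : ℕ) (pos : Bool) : Set Space3 :=
  twistBraid n k (if pos then 1 else -1)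

/-- Stacking (composition) of geometric braids. -/
def stackBraid (β γ : Set Space3) : Set Space3 :=
  {p | (p.2 ∈ Icc (0:ℝ) (1/2) ∧ (p.1, 2 * p.2) ∈ β) ∨
       (p.2 ∈ Icc (1/2 : ℝ) 1 ∧ (p.1, 2 * p.2 - 1) ∈ γ)}

/-- The geometric braid spelled by a word in the `σ`'s (1-indexed, `true` = positive). -/
def wordBraid (n : ℕ) : List (ℕ × Bool) → Set Space3
  | [] => trivBraid n
  | g :: w => stackBraid (sigmaBraid n g.1 g.2) (wordBraid n w)

/-- Equivalence of geometric `n`-braids (homotopy through braids rel endpoints),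
encoded by the compact total space of an interpolating family. -/
def BraidEquiv (n : ℕ) (β β' : Set Space3) : Prop :=
  ∃ W : Set (Space3 × ℝ), IsCompact W ∧ (∀ q ∈ W, q.2 ∈ unitI) ∧
    (∀ s ∈ unitI, IsGeomBraid n {q : Space3 | (q, s) ∈ W}) ∧
    ({q : Space3 | (q, (0:ℝ)) ∈ W} = β) ∧ ({q : Space3 | (q, (1:ℝ)) ∈ W} = β')

/-- The plat closure of a `2m`-braid: attach standard wickets below and above. -/
def platClosure3 (m : ℕ) (β : Set Space3) : Set Space3 :=
  β ∪ {p : Space3 | ((p.1, -p.2) : Space3) ∈ stdWickets m}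
    ∪ {p : Space3 | ((p.1, p.2 - 1) : Space3) ∈ stdWickets m}

/-- A trivial link with `m` components in `ℝ³`: the boundary of `m` disjoint disks. -/
def IsTrivialLinkOf (m : ℕ) (L : Set Space3) : Prop :=
  ∃ φ : Fin m → Plane → Space3,
    (∀ i, Continuous (φ i) ∧ InjOn (φ i) unitDisk) ∧
    (Pairwise fun i j => Disjoint (φ i '' unitDisk) (φ j '' unitDisk)) ∧
    L = ⋃ i, φ i '' unitCircle

def IsTrivialLink (L : Set Space3) : Prop := ∃ m : ℕ, 0 < m ∧ IsTrivialLinkOf m L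

def rescaleBraid (a : ℝ) (β : Set Space3) : Set Space3 :=
  (fun p : Space3 => ((p.1.1, a * p.1.2), p.2)) '' β

/-- The natural inclusion of an `n`-braid as the first `n` strands of an `N`-braid. -/
def inclBraid (n N : ℕ) (β : Set Space3) : Set Space3 :=
  rescaleBraid (((n:ℝ) + 1)/((N:ℝ) + 1)) β ∪
  {p | ∃ k : Fin N, n ≤ (k:ℕ) ∧ p.1 = qpt N (k:ℕ) ∧ p.2 ∈ unitI}

def stabWord (m l : ℕ) : List (ℕ × Bool) := (List.range l).map fun a => (2*(m+a), true)

/-- The `l`-fold stabilization of a `2m`-braid: `ι(β)·σ_{2m}σ_{2(m+1)}⋯σ_{2(m+l-1)}`. -/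
def stabilizeBraid (m l : ℕ) (β : Set Space3) : Set Space3 :=
  stackBraid (inclBraid (2*m) (2*(m+l)) β) (wordBraid (2*(m+l)) (stabWord m l))

def tauWord (k : ℕ) : List (ℕ × Bool) :=
  [(2*k, true), (2*k - 1, true), (2*k + 1, true), (2*k, true)]
def invWord (w : List (ℕ × Bool)) : List (ℕ × Bool) := w.reverse.map fun g => (g.1, !g.2)

/-- The word `T_{i,j} = (∏_{k=i}^{m-1} τ_k)·(∏_{k=m}^{j} τ_k⁻¹)`. -/
def TijWord (m i j : ℕ) : List (ℕ × Bool) :=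
  ((List.range (m - i)).map fun a => tauWord (i + a)).flatten ++
  ((List.range (j + 1 - m)).map fun a => invWord (tauWord (m + a))).flatten

/-- `|λ|_i = m + l₁ + ⋯ + l_i` for `λ = (l₁,…,l_m) ∈ Λ_m`. -/
def lamAbs {m : ℕ} (l : Fin m → ℕ) (i : ℕ) : ℕ :=
  m + ∑ k : Fin m, if (k:ℕ) < i then l k else 0

/-- The word `T(λ)`. -/
def TlamWord {m : ℕ} (l : Fin m → ℕ) : List (ℕ × Bool) :=
  ((List.range m).map fun i0 =>
    TijWord m (i0+1) (lamAbs l i0 - 1) ++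
    ((List.range (lamAbs l (i0+1) - lamAbs l i0)).map fun a => (2*(lamAbs l i0 + a), true)) ++
    invWord (TijWord m (i0+1) (lamAbs l i0 - 1))).flatten

/-- The generalized (`λ`-)stabilization `β^λ = ι(β)·T(λ)` of a `2m`-braid. -/
def genStabilize {m : ℕ} (l : Fin m → ℕ) (β : Set Space3) : Set Space3 :=
  stackBraid (inclBraid (2*m) (2*(lamAbs l m)) β) (wordBraid (2*(lamAbs l m)) (TlamWord l))

/-- Words spelling the generators of Hilden's subgroup `K_{2m}`:
`σ₁`, `σ₂σ₁σ₃σ₂` and `σ_{2i}σ_{2i-1}σ_{2i+1}⁻¹σ_{2i}⁻¹` for `1 ≤ i ≤ m-1`. -/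
def hildenGenWords (m : ℕ) : Set (List (ℕ × Bool)) :=
  {[(1, true)], [(2, true), (1, true), (3, true), (2, true)]} ∪
  ⋃ i : Fin (m - 1),
    {[(2*((i:ℕ)+1), true), (2*((i:ℕ)+1) - 1, true),
      (2*((i:ℕ)+1) + 1, false), (2*((i:ℕ)+1), false)]}

/-- The braid `γ` represents an element of Hilden's subgroup `K_{2m}`. -/
def InHildenSubgroup (m : ℕ) (γ : Set Space3) : Prop :=
  ∃ L : List (List (ℕ × Bool)),
    (∀ w ∈ L, w ∈ hildenGenWords m ∨ ∃ v ∈ hildenGenWords m, w = invWord v) ∧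
    BraidEquiv (2*m) γ (wordBraid (2*m) L.flatten)

/-- `β` and `β'` lie in the same double coset of `B_{2m}` modulo `K_{2m}`. -/
def SameHildenDoubleCoset (m : ℕ) (β β' : Set Space3) : Prop :=
  ∃ γ γ' : Set Space3, InHildenSubgroup m γ ∧ InHildenSubgroup m γ' ∧
    BraidEquiv (2*m) (stackBraid γ (stackBraid β γ')) β'

/-- A loop of wicket configurations based at the standard configuration, encoded by the
compact total space of the family. -/
structure IsWicketMotion (m : ℕ) (W : Set (Space3 × ℝ)) : Prop where
  compact : IsCompact W
  levels : ∀ q ∈ W, q.2 ∈ unitI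
  configs : ∀ t ∈ unitI, IsWicketConfig m {q : Space3 | (q, t) ∈ W}
  start : {q : Space3 | (q, (0:ℝ)) ∈ W} = stdWickets m
  finish : {q : Space3 | (q, (1:ℝ)) ∈ W} = stdWickets m

/-- The braid traced by the feet of a motion of wickets. -/
def motionBoundary (W : Set (Space3 × ℝ)) : Set Space3 :=
  {p | p.2 ∈ unitI ∧ ((p.1, (0:ℝ)), p.2) ∈ W}

/-- Two wicket motions are homotopic as loops in the space of wicket configurations. -/
def MotionHomotopic (m : ℕ) (W W' : Set (Space3 × ℝ)) : Prop :=
  ∃ Z : Set ((Space3 × ℝ) × ℝ), IsCompact Z ∧ (∀ z ∈ Z, z.2 ∈ unitI) ∧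
    (∀ s ∈ unitI, IsWicketMotion m {q : Space3 × ℝ | (q, s) ∈ Z}) ∧
    ({q : Space3 × ℝ | (q, (0:ℝ)) ∈ Z} = W) ∧ ({q : Space3 × ℝ | (q, (1:ℝ)) ∈ Z} = W')

def vEdges : Set Plane := ({0, 1} : Set ℝ) ×ˢ Icc (0:ℝ) 1
def hEdges : Set Plane := Icc (0:ℝ) 1 ×ˢ ({0, 1} : Set ℝ)

/-- A link in `ℝ³`: a disjoint union of embedded circles. -/
def IsLink3 (L : Set Space3) : Prop :=
  ∃ (m : ℕ) (ψ : Fin m → Plane → Space3), 0 < m ∧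
    (∀ i, Continuous (ψ i) ∧ InjOn (ψ i) unitCircle) ∧
    (Pairwise fun i j => Disjoint (ψ i '' unitCircle) (ψ j '' unitCircle)) ∧
    L = ⋃ i, ψ i '' unitCircle

/-- A family of mutually disjoint bands attached to a link `L`. -/
def IsBandFamily (L : Set Space3) {n : ℕ} (φ : Fin n → Plane → Space3) : Prop :=
  (∀ i, Continuous (φ i) ∧ InjOn (φ i) Dsq) ∧
  (Pairwise fun i j => Disjoint (φ i '' Dsq) (φ j '' Dsq)) ∧
  (∀ i, (φ i '' Dsq) ∩ L = φ i '' vEdges)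

/-- The link obtained from `L` by surgery along the bands. -/
def bandSurgery (L : Set Space3) {n : ℕ} (φ : Fin n → Plane → Space3) : Set Space3 :=
  (L \ ⋃ i, φ i '' vEdges) ∪ ⋃ i, φ i '' hEdges

/-- An admissible banded link: `L` and the surgered link are both trivial links. -/
def IsAdmissibleBandedLink (L : Set Space3) {n : ℕ} (φ : Fin n → Plane → Space3) : Prop :=
  IsLink3 L ∧ IsBandFamily L φ ∧ IsTrivialLink L ∧ IsTrivialLink (bandSurgery L φ)

/-- `d` is a disjoint union of embedded disks spanning the trivial link `L`. -/
def SpansDisks (L d : Set Space3) : Prop :=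
  ∃ (m : ℕ) (ψ : Fin m → Plane → Space3),
    (∀ i, Continuous (ψ i) ∧ InjOn (ψ i) unitDisk) ∧
    (Pairwise fun i j => Disjoint (ψ i '' unitDisk) (ψ j '' unitDisk)) ∧
    L = ⋃ i, ψ i '' unitCircle ∧ d = ⋃ i, ψ i '' unitDisk

/-- The closed realizing surface of a banded link, with chosen spanning disks `d`, `D`. -/
def RealizingSurface (L : Set Space3) {n : ℕ} (φ : Fin n → Plane → Space3)
    (d D : Set Space3) : Set Space4 :=
  {P | ∃ (q : Space3) (t : ℝ), P = emb34 q t ∧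
    ((t = 1 ∧ q ∈ D) ∨ (0 < t ∧ t < 1 ∧ q ∈ bandSurgery L φ) ∨
     (t = 0 ∧ q ∈ L ∪ ⋃ i, φ i '' Dsq) ∨ (-1 < t ∧ t < 0 ∧ q ∈ L) ∨ (t = -1 ∧ q ∈ d))}

/-- The union of circles (plus a base point) whose neighbourhood is a genus-`g`
handlebody; its distance level set is the standard genus-`g` surface. -/
def wedgeCircles (g : ℕ) : Set Space3 :=
  {(((0:ℝ), (0:ℝ)), (0:ℝ))} ∪
  ⋃ i : Fin g, {p : Space3 | (p.1.1 - (2*((i:ℕ):ℝ)+1))^2 + p.1.2^2 = 1 ∧ p.2 = 0}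

/-- The standard closed orientable surface of genus `g` (in `ℝ³`). -/
def stdGenusSurface (g : ℕ) : Set Space3 := {p | Metric.infDist p (wedgeCircles g) = 1/10}

def diskBoundaryPt (k : ℕ) (t : ℝ) : Plane :=
  (Real.cos (Real.pi * t / (k:ℝ)), Real.sin (Real.pi * t / (k:ℝ)))

/-- Boundary identifications of the `2k`-gon (disk) giving the word `a₁a₁a₂a₂⋯a_k a_k`. -/
def crosscapRel (k : ℕ) (p q : ↥unitDisk) : Prop :=
  ∃ i : Fin k, ∃ t : ℝ, (2*((i:ℕ):ℝ)) ≤ t ∧ t ≤ 2*((i:ℕ):ℝ) + 1 ∧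
    (p : Plane) = diskBoundaryPt k t ∧ (q : Plane) = diskBoundaryPt k (t+1)

/-- The closed non-orientable surface of genus `k` (sphere with `k` crosscaps). -/
def NonorientableModel (k : ℕ) : Type := Quot (crosscapRel k)

instance (k : ℕ) : TopologicalSpace (NonorientableModel k) :=
  TopologicalSpace.coinduced (Quot.mk (crosscapRel k)) inferInstance

/-- `F` (a closed surface in `ℝ⁴`) has Euler characteristic `c`:  it decomposes into
pieces homeomorphic to standard closed surfaces whose characteristics add up to `c`. -/
def HasEulerChar (F : Set Space4) (c : ℤ) : Prop :=
  ∃ (n : ℕ) (parts : Fin n → Set Space4) (chi : Fin n → ℤ),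
    (Pairwise fun i j => Disjoint (parts i) (parts j)) ∧ (F = ⋃ i, parts i) ∧
    (∀ i, (∃ g : ℕ, Nonempty (↥(parts i) ≃ₜ ↥(stdGenusSurface g)) ∧ chi i = 2 - 2*(g:ℤ)) ∨
          (∃ k : ℕ, 1 ≤ k ∧ Nonempty (↥(parts i) ≃ₜ NonorientableModel k) ∧ chi i = 2 - (k:ℤ))) ∧
    c = ∑ i, chi i

/-- The ball `B₀` inside which the twisting of a twist-spun knot takes place. -/
def ballB0 : Set Space3 := {p | p.1.1^2 + p.1.2^2 + (p.2 - 2)^2 ≤ 1}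
def inPt : Space3 := (((0:ℝ), (0:ℝ)), (1:ℝ))
def outPt : Space3 := (((0:ℝ), (0:ℝ)), (3:ℝ))

/-- A standard unknotted return path closing up a ball-arc in `B₀`. -/
def stdReturn : Set Space3 :=
  segment ℝ outPt (((3:ℝ), (0:ℝ)), (3:ℝ)) ∪
  segment ℝ (((3:ℝ), (0:ℝ)), (3:ℝ)) (((3:ℝ), (0:ℝ)), (1:ℝ)) ∪
  segment ℝ (((3:ℝ), (0:ℝ)), (1:ℝ)) inPt

/-- `β` is a ball-arc presentation (in `B₀`) of the knot `K`: an arc in `B₀` meeting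
`∂B₀` exactly in the two poles, whose standard closure is equivalent to `K`. -/
def IsBallArcOf (K β : Set Space3) : Prop :=
  β ⊆ ballB0 ∧ β ∩ frontier ballB0 = {inPt, outPt} ∧ IsArc β ∧
  AmbientIsotopic K (β ∪ stdReturn)

/-- The arc to be spun: approach `B₀` along the spinning axis, traverse the knotted
ball-arc `β`, and return to the spinning plane. -/
def spinArc (β : Set Space3) : Set Space3 :=
  segment ℝ (((0:ℝ), (0:ℝ)), (0:ℝ)) inPt ∪ β ∪
  segment ℝ outPt (((3:ℝ), (0:ℝ)), (3:ℝ)) ∪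
  segment ℝ (((3:ℝ), (0:ℝ)), (3:ℝ)) (((3:ℝ), (0:ℝ)), (0:ℝ))

/-- Spinning the half-space `{h ≥ 0} ⊂ ℝ³` around `ℝ² = {h = 0}` inside `ℝ⁴`. -/
def spinMap (a : ℝ) (q : Space3) : Space4 := (q.1, (q.2 * Real.cos a, q.2 * Real.sin a))
/-- The twisting rotation of `B₀` about its polar axis. -/
def twistRot (ψ : ℝ) (q : Space3) : Space3 := (rotPt ((0:ℝ), (0:ℝ)) ψ q.1, q.2)

/-- Zeeman's `tw`-twist spin of the ball-arc `β ⊂ B₀`. -/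
def TwistSpun (tw : ℤ) (β : Set Space3) : Set Space4 :=
  {P | ∃ a : ℝ,
    (∃ q ∈ spinArc β, q ∉ ballB0 ∧ P = spinMap a q) ∨
    (∃ q ∈ β, P = spinMap a (twistRot ((tw:ℝ) * a) q))}

/-- The twist knot `k(n)` (`n` full twists and a clasp), as the plat closure of the
4-braid `σ₂^{2n} σ₁²`. -/
def twistKnotModel (n : ℤ) : Set Space3 :=
  platClosure3 2 (stackBraid (twistBraid 4 2 (2*n)) (twistBraid 4 1 2))

/-- The height function on `ℝ⁴ = ℝ³ × ℝ`. -/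
def height4 (p : Space4) : ℝ := p.2.2
/-- The slice of `F ⊂ ℝ⁴` at height `r`, as a subset of `ℝ³`. -/
def levelSlice (F : Set Space4) (r : ℝ) : Set Space3 := {q | (q.1, (q.2, r)) ∈ F}

/-- `p` is a regular point of the height function on the surface `F`: there is a chart
around `p` in which the height is the second coordinate. -/
def HeightChartAt (F : Set Space4) (p : ↥F) : Prop :=
  ∃ U : Set ↥F, IsOpen U ∧ p ∈ U ∧
    ∃ φ : ↥U ≃ₜ Plane,
      ∀ q : ↥U, height4 ((q : ↥F) : Space4) = height4 (p : Space4) + (φ q).2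

/-- `p` is a minimal point of the height function on the surface `F`. -/
def HeightMinAt (F : Set Space4) (p : ↥F) : Prop :=
  ∃ U : Set ↥F, IsOpen U ∧ p ∈ U ∧ Nonempty (↥U ≃ₜ Plane) ∧
    ∀ q : ↥U, (q : ↥F) ≠ p → height4 (p : Space4) < height4 ((q : ↥F) : Space4)


/-- A family of perturbations of the identity by contractions is a family of homeomorphisms. -/
theorem pert_homeo {E : Type*} [NormedAddCommGroup E] [NormedSpace ℝ E] [CompleteSpace E]
    (g : ℝ → E → E) (hg : Continuous (fun p : ℝ × E => g p.1 p.2))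
    (hL : ∀ t x y, ‖g t x - g t y‖ ≤ 1/2 * ‖x - y‖) :
    ∃ H : ℝ → E ≃ₜ E, (∀ t x, H t x = x + g t x) ∧
      Continuous (fun p : ℝ × E => H p.1 p.2) ∧
      Continuous (fun p : ℝ × E => (H p.1).symm p.2) := by
  have anti : ∀ t x y, ‖x - y‖ ≤ 2 * ‖(x + g t x) - (y + g t y)‖ := by
    intro t x y
    have h1 := hL t x y
    have h2 : x - y = ((x + g t x) - (y + g t y)) - (g t x - g t y) := by abel
    have h3 := norm_sub_le ((x + g t x) - (y + g t y)) (g t x - g t y)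
    rw [← h2] at h3
    linarith
  have inj : ∀ t, Function.Injective (fun x => x + g t x) := by
    intro t x y hxy
    have := anti t x y
    simp only at hxy
    rw [hxy, sub_self, norm_zero, mul_zero] at this
    exact sub_eq_zero.mp (norm_le_zero_iff.mp this)
  have surj : ∀ t, Function.Surjective (fun x => x + g t x) := by
    intro t y
    have hc : ContractingWith (1/2) (fun x => y - g t x) := by
      refine ⟨by norm_num, LipschitzWith.of_dist_le_mul fun a b => ?_⟩
      rw [dist_eq_norm, dist_eq_norm]
      have h2 : y - g t a - (y - g t b) = -(g t a - g t b) := by abel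
      rw [h2, norm_neg]
      simpa using hL t a b
    refine ⟨hc.fixedPoint, ?_⟩
    have := hc.fixedPoint_isFixedPt
    unfold Function.IsFixedPt at this
    simp only at this ⊢
    nth_rewrite 1 [← this]
    abel
  let e : ℝ → E ≃ E := fun t => Equiv.ofBijective (fun x => x + g t x) ⟨inj t, surj t⟩
  have he : ∀ t x, e t x = x + g t x := fun t x => rfl
  have hes : ∀ t y, (e t).symm y + g t ((e t).symm y) = y := by
    intro t y
    rw [← he, Equiv.apply_symm_apply]
  have hcont : Continuous (fun p : ℝ × E => e p.1 p.2) := by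
    simp only [he]
    exact continuous_snd.add hg
  have hconts : Continuous (fun p : ℝ × E => (e p.1).symm p.2) := by
    rw [continuous_iff_continuousAt]
    rintro ⟨s, z⟩
    rw [ContinuousAt, tendsto_iff_norm_sub_tendsto_zero]
    set x0 := (e s).symm z with hx0
    have hlim : Filter.Tendsto (fun p : ℝ × E => 2 * ‖p.2 - (x0 + g p.1 x0)‖)
        (nhds (s, z)) (nhds 0) := by
      have hc : Continuous (fun p : ℝ × E => 2 * ‖p.2 - (x0 + g p.1 x0)‖) := by
        have : Continuous (fun p : ℝ × E => g p.1 x0) :=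
          hg.comp (continuous_fst.prodMk continuous_const)
        fun_prop
      have h0 := hc.tendsto (s, z)
      have : x0 + g s x0 = z := hes s z
      simpa [this] using h0
    refine squeeze_zero (fun _ => norm_nonneg _) (fun p => ?_) hlim
    have := anti p.1 ((e p.1).symm p.2) x0
    rwa [hes] at this
  refine ⟨fun t => ⟨e t, ?_, ?_⟩, he, hcont, hconts⟩
  · exact hcont.comp (continuous_const.prodMk continuous_id)
  · exact hconts.comp (continuous_const.prodMk continuous_id)

/-- Smooth cut-off functions. -/
theorem exists_cutoff {E : Type*} [NormedAddCommGroup E] [NormedSpace ℝ E]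
    [FiniteDimensional ℝ E] {C K : Set E} (hC : IsCompact C) (hK : IsClosed K)
    (hd : Disjoint C K) :
    ∃ l : E → ℝ, ContDiff ℝ 1 l ∧ HasCompactSupport l ∧ (∀ x ∈ C, l x = 1) ∧
      (∀ x ∈ K, l x = 0) := by
  have : ProperSpace E := FiniteDimensional.proper ℝ E
  obtain ⟨R, hR⟩ := hC.isBounded.subset_ball (0 : E)
  have hcl : IsClosed (K ∪ (Metric.ball (0:E) R)ᶜ) :=
    hK.union Metric.isOpen_ball.isClosed_compl
  have hdis : Disjoint (K ∪ (Metric.ball (0:E) R)ᶜ) C := by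
    rw [Set.disjoint_union_left]
    exact ⟨hd.symm, Set.disjoint_compl_left_iff_subset.mpr hR⟩
  obtain ⟨f, h0, h1, -⟩ := exists_contMDiffMap_zero_one_of_isClosed (n := 1)
    (modelWithCornersSelf ℝ E) hcl hC.isClosed hdis
  refine ⟨f, ?_, ?_, fun x hx => h1 hx, fun x hx => h0 (Or.inl hx)⟩
  · exact f.contMDiff.contDiff
  · refine HasCompactSupport.intro (isCompact_closedBall (0:E) R) fun x hx => ?_
    exact h0 (Or.inr fun h => hx (Metric.ball_subset_closedBall h))

/-- Parametrization of a wicket. -/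
def wPar (a b : Plane) (θ : ℝ) : Space3 :=
  ((1/2 : ℝ) • (a + b) + Real.cos θ • ((1/2 : ℝ) • (a - b)),
         Real.sqrt (((a.1 - b.1)/2)^2 + ((a.2 - b.2)/2)^2) * Real.sin θ)

theorem wicketArc_eq (a b : Plane) : wicketArc a b = wPar a b '' Icc 0 Real.pi := by
  ext p
  simp only [wicketArc, wPar, Set.mem_ofPred_eq, Set.mem_image]
  constructor
  · rintro ⟨θ, h, rfl⟩; exact ⟨θ, h, rfl⟩
  · rintro ⟨θ, h, rfl⟩; exact ⟨θ, h, rfl⟩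

theorem wPar_continuous : Continuous (fun q : (Plane × Plane) × ℝ => wPar q.1.1 q.1.2 q.2) := by
  unfold wPar
  fun_prop

theorem wPar_cont (a b : Plane) : Continuous (wPar a b) := by
  unfold wPar
  fun_prop

theorem wicketArc_compact (a b : Plane) : IsCompact (wicketArc a b) := by
  rw [wicketArc_eq]
  exact isCompact_Icc.image (wPar_cont a b)

theorem wicketArc_preconnected (a b : Plane) : IsPreconnected (wicketArc a b) := by
  rw [wicketArc_eq]
  exact isPreconnected_Icc.image _ (wPar_cont a b).continuousOn

theorem wPar_zero (a b : Plane) : wPar a b 0 = (a, 0) := by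
  ext <;> simp [wPar] <;> ring

theorem wPar_pi (a b : Plane) : wPar a b Real.pi = (b, 0) := by
  ext <;> simp [wPar] <;> ring

theorem wPar_swap (a b : Plane) (θ : ℝ) : wPar b a (Real.pi - θ) = wPar a b θ := by
  have h : ((b.1 - a.1)/2)^2 + ((b.2 - a.2)/2)^2 = ((a.1 - b.1)/2)^2 + ((a.2 - b.2)/2)^2 := by
    ring
  ext <;> simp [wPar, h] <;> ring

theorem wicketArc_swap (a b : Plane) : wicketArc b a = wicketArc a b := by
  have key : ∀ a b : Plane, wicketArc a b ⊆ wicketArc b a := by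
    intro a b
    rw [wicketArc_eq, wicketArc_eq]
    rintro _ ⟨θ, h, rfl⟩
    exact ⟨Real.pi - θ, ⟨by linarith [h.2], by linarith [h.1]⟩, wPar_swap a b θ⟩
  exact Set.Subset.antisymm (key _ _) (key _ _)

theorem left_mem (a b : Plane) : ((a, 0) : Space3) ∈ wicketArc a b := by
  rw [wicketArc_eq]
  exact ⟨0, ⟨le_rfl, Real.pi_pos.le⟩, wPar_zero a b⟩

theorem right_mem (a b : Plane) : ((b, 0) : Space3) ∈ wicketArc a b := by
  rw [wicketArc_swap]; exact left_mem b a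

theorem rad_pos {a b : Plane} (h : a ≠ b) :
    0 < ((a.1 - b.1)/2)^2 + ((a.2 - b.2)/2)^2 := by
  by_contra hn
  have h1 : ((a.1 - b.1)/2)^2 = 0 := by nlinarith [sq_nonneg ((a.1 - b.1)/2), sq_nonneg ((a.2 - b.2)/2)]
  have h2 : ((a.2 - b.2)/2)^2 = 0 := by nlinarith [sq_nonneg ((a.1 - b.1)/2), sq_nonneg ((a.2 - b.2)/2)]
  rw [sq_eq_zero_iff] at h1 h2
  exact h (Prod.ext (by linarith) (by linarith))

theorem foot_of_mem {a b x : Plane} (h : a ≠ b) (hx : ((x, 0) : Space3) ∈ wicketArc a b) :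
    x = a ∨ x = b := by
  rw [wicketArc_eq] at hx
  obtain ⟨θ, hθ, he⟩ := hx
  have h2 := congrArg Prod.snd he
  simp only [wPar] at h2
  have hr : Real.sqrt (((a.1 - b.1)/2)^2 + ((a.2 - b.2)/2)^2) ≠ 0 :=
    (Real.sqrt_pos.mpr (rad_pos h)).ne'
  have hs : Real.sin θ = 0 := by
    rcases mul_eq_zero.mp h2 with h3 | h3
    · exact absurd h3 hr
    · exact h3
  have : θ = 0 ∨ θ = Real.pi := by
    by_contra hn
    push Not at hn
    exact (Real.sin_pos_of_pos_of_lt_pi (lt_of_le_of_ne hθ.1 (Ne.symm hn.1))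
      (lt_of_le_of_ne hθ.2 hn.2)).ne' hs
  rcases this with rfl | rfl
  · left; rw [wPar_zero] at he; exact (congrArg Prod.fst he).symm
  · right; rw [wPar_pi] at he; exact (congrArg Prod.fst he).symm

theorem wicketArc_nonneg {a b : Plane} {p : Space3} (hp : p ∈ wicketArc a b) : 0 ≤ p.2 := by
  rw [wicketArc_eq] at hp
  obtain ⟨θ, hθ, rfl⟩ := hp
  exact mul_nonneg (Real.sqrt_nonneg _) (Real.sin_nonneg_of_nonneg_of_le_pi hθ.1 hθ.2)


/-- The map preserves the level zero and the upper half space. -/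
def HP (f : Space3 → Space3) : Prop :=
  ∀ x, ((f x).2 = 0 ↔ x.2 = 0) ∧ (0 < (f x).2 ↔ 0 < x.2)

/-- An isotopy preserving the level zero and the upper half space. -/
structure HIso (Φ : ℝ → Space3 ≃ₜ Space3) : Prop where
  cont : Continuous (fun p : ℝ × Space3 => Φ p.1 p.2)
  conts : Continuous (fun p : ℝ × Space3 => (Φ p.1).symm p.2)
  hp : ∀ t, HP (Φ t)

theorem HP.symm {e : Space3 ≃ₜ Space3} (h : HP e) : HP e.symm := by
  intro x
  have := h (e.symm x)
  rw [e.apply_symm_apply] at this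
  exact ⟨this.1.symm, this.2.symm⟩

theorem HP.comp {f g : Space3 → Space3} (hf : HP f) (hg : HP g) : HP (fun x => f (g x)) :=
  fun x => ⟨(hf _).1.trans (hg x).1, (hf _).2.trans (hg x).2⟩

/-- The local displacement moving one wicket. -/
theorem wicket_displacement (t0 : ℝ) (a b : ℝ → Plane) (ha : Continuous a) (hb : Continuous b)
    (hab : a t0 ≠ b t0) (K : Set Space3) (hK : IsClosed K)
    (hd : Disjoint (wicketArc (a t0) (b t0)) K) :
    ∃ (F : ℝ → Space3 → Space3) (M : ℝ → ℝ),
      Continuous (fun p : ℝ × Space3 => F p.1 p.2) ∧ Continuous M ∧ M t0 = 0 ∧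
      (∀ t x y, ‖F t x - F t y‖ ≤ M t * ‖x - y‖) ∧
      (∀ t (x : Plane), (F t (x, 0)).2 = 0) ∧
      (∀ t, ∀ x ∈ K, F t x = 0) ∧
      (∀ t θ, θ ∈ Icc 0 Real.pi →
        F t (wPar (a t0) (b t0) θ) = wPar (a t) (b t) θ - wPar (a t0) (b t0) θ) := by
  obtain ⟨l, hl, hls, hl1, hl0⟩ := exists_cutoff (wicketArc_compact (a t0) (b t0)) hK hd
  set v : Plane := (1/2 : ℝ) • (a t0 - b t0) with hv
  set c : Plane := (1/2 : ℝ) • (a t0 + b t0) with hc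
  let r : ℝ → ℝ := fun t => Real.sqrt (((a t).1 - (b t).1)/2 * (((a t).1 - (b t).1)/2)
    + ((a t).2 - (b t).2)/2 * (((a t).2 - (b t).2)/2))
  have hr' : ∀ t, r t = Real.sqrt ((((a t).1 - (b t).1)/2)^2 + (((a t).2 - (b t).2)/2)^2) := by
    intro t; simp only [r, sq]
  have hrc : Continuous r := by fun_prop
  have hr0 : r t0 ≠ 0 := by rw [hr']; exact (Real.sqrt_pos.mpr (rad_pos hab)).ne'
  have hN : v.1 * v.1 + v.2 * v.2 ≠ 0 := by
    have := rad_pos hab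
    have h2 : v.1 * v.1 + v.2 * v.2 =
      (((a t0).1 - (b t0).1)/2)^2 + (((a t0).2 - (b t0).2)/2)^2 := by
      simp [hv]; ring
    rw [h2]; exact this.ne'
  let N := v.1 * v.1 + v.2 * v.2
  let co : Space3 → ℝ := fun x => ((x.1.1 - c.1) * v.1 + (x.1.2 - c.2) * v.2) / N
  have hco : ContDiff ℝ 1 co := by
    simp only [co]
    fun_prop
  have lip : ∀ h : Space3 → ℝ, ContDiff ℝ 1 h →
      ∃ C : ℝ, 0 ≤ C ∧ ∀ x y, ‖l x * h x - l y * h y‖ ≤ C * ‖x - y‖ := by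
    intro h hh
    obtain ⟨C, hC⟩ := ContDiff.lipschitzWith_of_hasCompactSupport
      (f := fun x => l x * h x) (𝕂 := ℝ) (hls.mul_right) (hl.mul hh) one_ne_zero
    exact ⟨C, C.2, fun x y => hC.norm_sub_le x y⟩
  obtain ⟨C1, hC1, hL1⟩ := lip (fun _ => 1) contDiff_const
  obtain ⟨C2, hC2, hL2⟩ := lip co hco
  obtain ⟨C3, hC3, hL3⟩ := lip (fun x => x.2 / r t0) (by fun_prop)
  let d1 : ℝ → Space3 := fun t => ((1/2 : ℝ) • (a t + b t) - c, 0)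
  let d2 : ℝ → Space3 := fun t => ((1/2 : ℝ) • (a t - b t) - v, 0)
  let d3 : ℝ → Space3 := fun t => (0, r t - r t0)
  have hd1 : Continuous d1 := by fun_prop
  have hd2 : Continuous d2 := by fun_prop
  have hd3 : Continuous d3 := by fun_prop
  have hlc : Continuous l := hl.continuous
  have hcoc : Continuous co := hco.continuous
  refine ⟨fun t x => (l x * 1) • d1 t + (l x * co x) • d2 t + (l x * (x.2 / r t0)) • d3 t,
    fun t => C1 * ‖d1 t‖ + C2 * ‖d2 t‖ + C3 * ‖d3 t‖, ?_, ?_, ?_, ?_, ?_, ?_, ?_⟩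
  · fun_prop
  · fun_prop
  · have e1 : d1 t0 = 0 := by simp [d1, hc]
    have e2 : d2 t0 = 0 := by simp [d2, hv]
    have e3 : d3 t0 = 0 := by simp [d3]
    simp [e1, e2, e3]
  · intro t x y
    have e : ((l x * 1) • d1 t + (l x * co x) • d2 t + (l x * (x.2 / r t0)) • d3 t)
      - ((l y * 1) • d1 t + (l y * co y) • d2 t + (l y * (y.2 / r t0)) • d3 t)
      = (l x * 1 - l y * 1) • d1 t + (l x * co x - l y * co y) • d2 t
        + (l x * (x.2 / r t0) - l y * (y.2 / r t0)) • d3 t := by module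
    simp only
    rw [e]
    have n1 : ‖(l x * 1 - l y * 1) • d1 t‖ ≤ C1 * ‖x - y‖ * ‖d1 t‖ := by
      rw [norm_smul]; exact mul_le_mul_of_nonneg_right (hL1 x y) (norm_nonneg _)
    have n2 : ‖(l x * co x - l y * co y) • d2 t‖ ≤ C2 * ‖x - y‖ * ‖d2 t‖ := by
      rw [norm_smul]; exact mul_le_mul_of_nonneg_right (hL2 x y) (norm_nonneg _)
    have n3 : ‖(l x * (x.2 / r t0) - l y * (y.2 / r t0)) • d3 t‖ ≤ C3 * ‖x - y‖ * ‖d3 t‖ := by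
      rw [norm_smul]; exact mul_le_mul_of_nonneg_right (hL3 x y) (norm_nonneg _)
    refine (norm_add₃_le).trans ?_
    nlinarith
  · intro t x
    simp [d1, d2, d3]
  · intro t x hx
    simp [hl0 x hx]
  · intro t θ hθ
    have hm : wPar (a t0) (b t0) θ ∈ wicketArc (a t0) (b t0) := by
      rw [wicketArc_eq]; exact ⟨θ, hθ, rfl⟩
    have hco' : co (wPar (a t0) (b t0) θ) = Real.cos θ := by
      simp only [co]
      rw [div_eq_iff hN]
      simp only [wPar, ← hv, ← hc, Prod.fst_add, Prod.snd_add, Prod.smul_fst, Prod.smul_snd,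
        smul_eq_mul]
      ring
    have hh : (wPar (a t0) (b t0) θ).2 / r t0 = Real.sin θ := by
      rw [div_eq_iff hr0, hr']
      simp only [wPar]
      ring
    simp only [hl1 _ hm, hco', hh, one_mul]
    have hw : ∀ s, wPar (a s) (b s) θ = ((1/2 : ℝ) • (a s + b s) +
      Real.cos θ • ((1/2 : ℝ) • (a s - b s)), r s * Real.sin θ) := by
      intro s; rw [hr']; rfl
    rw [hw, hw]
    refine Prod.ext ?_ ?_
    · simp only [d1, d2, d3, Prod.fst_add, Prod.smul_fst, Prod.fst_sub, smul_zero, add_zero,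
        ← hv, ← hc]
      module
    · simp only [d1, d2, d3, Prod.snd_add, Prod.smul_snd, Prod.snd_sub, smul_eq_mul]
      ring

theorem local_step (m : ℕ) (V : ℝ → Set Space3) (t0 : ℝ) (a b : Fin m → ℝ → Plane)
    (ha : ∀ i, Continuous (a i)) (hb : ∀ i, Continuous (b i))
    (hab : ∀ i, a i t0 ≠ b i t0)
    (hd : Pairwise fun i j => Disjoint (wicketArc (a i t0) (b i t0)) (wicketArc (a j t0) (b j t0)))
    (hV : ∀ᶠ t in nhds t0, V t = ⋃ i, wicketArc (a i t) (b i t)) :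
    ∃ ε > 0, ∃ Ψ : ℝ → Space3 ≃ₜ Space3, HIso Ψ ∧
      ∀ t ∈ Icc (t0 - ε) (t0 + ε), Ψ t '' V t0 = V t := by
  have H : ∀ i, _ := fun i => wicket_displacement t0 (a i) (b i) (ha i) (hb i) (hab i)
    (⋃ j ∈ ({i}ᶜ : Set (Fin m)), wicketArc (a j t0) (b j t0))
    ((Set.toFinite _).isClosed_biUnion fun j _ => (wicketArc_compact _ _).isClosed)
    (by
      rw [Set.disjoint_iUnion₂_right]
      intro j hj
      exact hd (fun h => hj h.symm))
  choose F M hF hM hM0 hFM hFz hFK hFw using H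
  have hsum : Continuous (fun t => ∑ i, M i t) := continuous_finsetSum _ fun i _ => hM i
  have hev : ∀ᶠ t in nhds t0, ∑ i, M i t < 1/2 := by
    refine hsum.continuousAt.eventually_lt continuousAt_const ?_
    simp [hM0]
  obtain ⟨ε', hε', hball⟩ := Metric.eventually_nhds_iff.mp (hev.and hV)
  let ε := ε' / 2
  have hε : 0 < ε := by simp only [ε]; linarith
  have hin : ∀ t ∈ Icc (t0 - ε) (t0 + ε), dist t t0 < ε' := by
    intro t ht
    rw [Real.dist_eq, abs_lt]
    simp only [ε] at ht
    constructor <;> linarith [ht.1, ht.2]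
  let cl : ℝ → ℝ := fun t => max (t0 - ε) (min (t0 + ε) t)
  have hcl : ∀ t, cl t ∈ Icc (t0 - ε) (t0 + ε) := fun t =>
    ⟨le_max_left _ _, max_le (by linarith) (min_le_left _ _)⟩
  have hcle : ∀ t ∈ Icc (t0 - ε) (t0 + ε), cl t = t := by
    intro t ht
    simp only [cl]
    rw [min_eq_right ht.2, max_eq_right ht.1]
  have hclc : Continuous cl := by fun_prop
  let g : ℝ → Space3 → Space3 := fun t x => ∑ i, F i (cl t) x
  have hg : Continuous (fun p : ℝ × Space3 => g p.1 p.2) := by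
    refine continuous_finsetSum _ fun i _ => ?_
    exact (hF i).comp ((hclc.comp continuous_fst).prodMk continuous_snd)
  have hgL : ∀ t x y, ‖g t x - g t y‖ ≤ 1/2 * ‖x - y‖ := by
    intro t x y
    simp only [g]
    rw [← Finset.sum_sub_distrib]
    refine (norm_sum_le _ _).trans ?_
    refine (Finset.sum_le_sum fun i _ => hFM i (cl t) x y).trans ?_
    rw [← Finset.sum_mul]
    exact mul_le_mul_of_nonneg_right (hball (hin _ (hcl t))).1.le (norm_nonneg _)
  obtain ⟨Ψ, h1, h2, h3⟩ := pert_homeo g hg hgL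
  refine ⟨ε, hε, Ψ, ⟨h2, h3, ?_⟩, ?_⟩
  · intro t x
    have hz : (g t (x.1, 0)).2 = 0 := by
      simp only [g, Prod.snd_sum]
      exact Finset.sum_eq_zero fun i _ => hFz i _ _
    have hle : |(g t x).2| ≤ 1/2 * |x.2| := by
      have q1 := hgL t x (x.1, 0)
      have q2 : x - (x.1, 0) = (0, x.2) := by ext <;> simp
      have q3 : ‖((0, x.2) : Space3)‖ = |x.2| := by simp [Prod.norm_def]
      have q4 : |(g t x - g t (x.1, 0)).2| ≤ ‖g t x - g t (x.1, 0)‖ := by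
        rw [← Real.norm_eq_abs]; exact norm_snd_le _
      rw [Prod.snd_sub, hz, sub_zero] at q4
      rw [q2, q3] at q1
      exact q4.trans q1
    rw [h1, Prod.snd_add]
    rw [abs_le] at hle
    rcases lt_trichotomy x.2 0 with hx | hx | hx
    · rw [abs_of_neg hx] at hle
      exact ⟨⟨fun h => by linarith [hle.2], fun h => by linarith⟩,
        ⟨fun h => by linarith [hle.2], fun h => by linarith⟩⟩
    · rw [hx, abs_zero, mul_zero] at hle
      have : (g t x).2 = 0 := by linarith [hle.1, hle.2]
      rw [hx, this]; simp
    · rw [abs_of_pos hx] at hle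
      exact ⟨⟨fun h => by linarith [hle.1], fun h => by linarith⟩,
        ⟨fun h => by linarith [hle.1], fun h => by linarith [hle.1]⟩⟩
  · intro t ht
    rw [(hball (hin t ht)).2, hV.self_of_nhds, Set.image_iUnion]
    refine Set.iUnion_congr fun i => ?_
    have key : ∀ θ ∈ Icc 0 Real.pi, Ψ t (wPar (a i t0) (b i t0) θ) = wPar (a i t) (b i t) θ := by
      intro θ hθ
      have hm : wPar (a i t0) (b i t0) θ ∈ wicketArc (a i t0) (b i t0) := by
        rw [wicketArc_eq]; exact ⟨θ, hθ, rfl⟩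
      rw [h1]
      simp only [g]
      rw [Finset.sum_eq_single i, hFw i _ θ hθ, hcle t ht]
      · abel
      · intro j _ hj
        refine hFK j _ _ (Set.mem_biUnion (x := i) ?_ hm)
        exact fun h => hj h.symm
      · intro h; exact absurd (Finset.mem_univ i) h
    rw [wicketArc_eq, wicketArc_eq, Set.image_image]
    exact Set.image_congr key

/-- Isotopy extension for motions which are locally motions of wickets. -/
theorem isotopy_extension (m : ℕ) (V : ℝ → Set Space3) (hneg : ∀ t ≤ 0, V t = V 0)
    (hloc : ∀ t0, ∃ a b : Fin m → ℝ → Plane,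
      (∀ i, Continuous (a i)) ∧ (∀ i, Continuous (b i)) ∧ (∀ i, a i t0 ≠ b i t0) ∧
      (Pairwise fun i j => Disjoint (wicketArc (a i t0) (b i t0)) (wicketArc (a j t0) (b j t0))) ∧
      (∀ᶠ t in nhds t0, V t = ⋃ i, wicketArc (a i t) (b i t))) :
    ∃ Φ : ℝ → Space3 ≃ₜ Space3, HIso Φ ∧ Φ 0 = Homeomorph.refl _ ∧
      ∀ t ≤ 1, Φ t '' V 0 = V t := by
  let S : Set ℝ := {T | ∃ Φ : ℝ → Space3 ≃ₜ Space3, HIso Φ ∧ ∀ t ≤ T, Φ t '' V 0 = V t}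
  have hS : ∀ t0, ∃ ε > 0, ∀ T ∈ Icc (t0 - ε) (t0 + ε), ∀ T' ∈ Icc (t0 - ε) (t0 + ε),
      T ∈ S → T' ∈ S := by
    intro t0
    obtain ⟨a, b, h1, h2, h3, h4, h5⟩ := hloc t0
    obtain ⟨ε, hε, Ψ, hΨ, hΨV⟩ := local_step m V t0 a b h1 h2 h3 h4 h5
    refine ⟨ε, hε, ?_⟩
    rintro T hT T' hT' ⟨Φ, hΦ, hΦV⟩
    refine ⟨fun t => (Φ (min t T)).trans ((Ψ T).symm.trans (Ψ (max t T))), ⟨?_, ?_, ?_⟩, ?_⟩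
    · simp only [Homeomorph.trans_apply]
      have c1 : Continuous fun p : ℝ × Space3 => (Ψ T).symm (Φ (min p.1 T) p.2) :=
        (Ψ T).symm.continuous.comp (hΦ.cont.comp
          ((continuous_fst.min continuous_const).prodMk continuous_snd))
      exact hΨ.cont.comp ((continuous_fst.max continuous_const).prodMk c1)
    · simp only [Homeomorph.symm_trans_apply, Homeomorph.symm_symm]
      have c1 : Continuous fun p : ℝ × Space3 => (Ψ T) ((Ψ (max p.1 T)).symm p.2) :=
        (Ψ T).continuous.comp (hΨ.conts.comp
          ((continuous_fst.max continuous_const).prodMk continuous_snd))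
      exact hΦ.conts.comp ((continuous_fst.min continuous_const).prodMk c1)
    · intro t
      exact (hΨ.hp _).comp ((hΨ.hp T).symm.comp (hΦ.hp _))
    · intro t ht
      have e : (fun x => ((Φ (min t T)).trans ((Ψ T).symm.trans (Ψ (max t T)))) x) '' V 0
          = Ψ (max t T) '' ((Ψ T).symm '' (Φ (min t T) '' V 0)) := by
        rw [Set.image_image, Set.image_image]
        rfl
      refine e.trans ?_
      have hT0 : (Ψ T).symm '' V T = V t0 := by
        rw [← hΨV T hT, Set.image_image]
        simp
      rcases le_total t T with h | h
      · rw [min_eq_left h, max_eq_right h, hΦV t h, Set.image_image]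
        simp
      · rw [min_eq_right h, max_eq_left h, hΦV T le_rfl, hT0]
        exact hΨV t ⟨hT.1.trans h, ht.trans hT'.2⟩
  have hclopen : IsClopen S := by
    constructor
    · rw [← isOpen_compl_iff, Metric.isOpen_iff]
      intro t0 ht0
      obtain ⟨ε, hε, h⟩ := hS t0
      refine ⟨ε, hε, fun T hT hTS => ht0 (h T ?_ t0 ⟨by linarith, by linarith⟩ hTS)⟩
      rw [Metric.mem_ball, Real.dist_eq, abs_lt] at hT
      exact ⟨by linarith [hT.1], by linarith [hT.2]⟩
    · rw [Metric.isOpen_iff]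
      intro t0 ht0
      obtain ⟨ε, hε, h⟩ := hS t0
      refine ⟨ε, hε, fun T hT => (h t0 ⟨by linarith, by linarith⟩ T ?_ ht0)⟩
      rw [Metric.mem_ball, Real.dist_eq, abs_lt] at hT
      exact ⟨by linarith [hT.1], by linarith [hT.2]⟩
  have h0 : (0:ℝ) ∈ S := by
    refine ⟨fun _ => Homeomorph.refl _, ⟨continuous_snd, continuous_snd, fun t x => by simp⟩, ?_⟩
    intro t ht
    rw [hneg t ht]; simp
  have huniv := hclopen.eq_univ ⟨0, h0⟩
  have h1 : (1:ℝ) ∈ S := by rw [huniv]; trivial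
  obtain ⟨Φ, hΦ, hV⟩ := h1
  refine ⟨fun t => (Φ 0).symm.trans (Φ t), ⟨?_, ?_, ?_⟩, ?_, ?_⟩
  · exact hΦ.cont.comp (continuous_fst.prodMk ((Φ 0).symm.continuous.comp continuous_snd))
  · exact (Φ 0).continuous.comp hΦ.conts
  · intro t; exact (hΦ.hp t).comp (hΦ.hp 0).symm
  · ext1 x; simp
  · intro t ht
    have e : (fun x => ((Φ 0).symm.trans (Φ t)) x) '' V 0 = Φ t '' ((Φ 0).symm '' V 0) := by
      rw [Set.image_image]; rfl
    refine e.trans ?_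
    have : (Φ 0).symm '' V 0 = V 0 := by
      nth_rewrite 1 [← hV 0 zero_le_one]
      rw [Set.image_image]; simp
    rw [this, hV t ht]


/-- A wicket contained in a configuration of wickets is one of them. -/
theorem wicket_sub_config {m : ℕ} {e : Fin m → Plane × Plane} (he : ∀ i, (e i).1 ≠ (e i).2)
    (hd : Pairwise fun i j => Disjoint (wicketArc (e i).1 (e i).2) (wicketArc (e j).1 (e j).2))
    {p q : Plane} (hpq : p ≠ q) (hsub : wicketArc p q ⊆ ⋃ i, wicketArc (e i).1 (e i).2) :
    ∃ i, (p = (e i).1 ∧ q = (e i).2) ∨ (p = (e i).2 ∧ q = (e i).1) := by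
  obtain ⟨i, hi⟩ := Set.mem_iUnion.mp (hsub (left_mem p q))
  refine ⟨i, ?_⟩
  have hpre := isPreconnected_iff_subset_of_disjoint_closed.mp (wicketArc_preconnected p q)
    (wicketArc (e i).1 (e i).2) (⋃ j ∈ ({i}ᶜ : Set (Fin m)), wicketArc (e j).1 (e j).2)
    (wicketArc_compact _ _).isClosed
    ((Set.toFinite _).isClosed_biUnion fun j _ => (wicketArc_compact _ _).isClosed)
    (by
      intro x hx
      obtain ⟨j, hj⟩ := Set.mem_iUnion.mp (hsub hx)
      by_cases h : j = i
      · subst h; exact Or.inl hj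
      · exact Or.inr (Set.mem_biUnion (x := j) h hj))
    (by
      have : Disjoint (wicketArc (e i).1 (e i).2)
          (⋃ j ∈ ({i}ᶜ : Set (Fin m)), wicketArc (e j).1 (e j).2) := by
        rw [Set.disjoint_iUnion₂_right]
        intro j hj
        exact hd (fun h => hj h.symm)
      rw [this.inter_eq, Set.inter_empty])
  have hin : wicketArc p q ⊆ wicketArc (e i).1 (e i).2 := by
    rcases hpre with h | h
    · exact h
    · exfalso
      obtain ⟨j, hj, hmem⟩ := Set.mem_iUnion₂.mp (h (left_mem p q))
      exact Set.disjoint_left.mp (hd (fun h => hj h.symm : i ≠ j)) hi hmem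
  have f1 := foot_of_mem (he i) (hin (left_mem p q))
  have f2 := foot_of_mem (he i) (hin (right_mem p q))
  rcases f1 with f1 | f1 <;> rcases f2 with f2 | f2
  · exact absurd (f1.trans f2.symm) hpq
  · exact Or.inl ⟨f1, f2⟩
  · exact Or.inr ⟨f1, f2⟩
  · exact absurd (f1.trans f2.symm) hpq

theorem local_wickets (m n : ℕ) (V : ℝ → Set Space3)
    (hcl : IsClosed {p : Space3 × ℝ | p.1 ∈ V p.2})
    (hw : ∀ t, IsWicketConfig m (V t)) (c : Fin n → ℝ → Plane) (hc : ∀ j, Continuous (c j))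
    (hinj : ∀ t j k, c j t = c k t → j = k)
    (hfeet : ∀ t x, ((x, 0) : Space3) ∈ V t ↔ ∃ j, x = c j t) (t0 : ℝ) :
    ∃ a b : Fin m → ℝ → Plane,
      (∀ i, Continuous (a i)) ∧ (∀ i, Continuous (b i)) ∧ (∀ i, a i t0 ≠ b i t0) ∧
      (Pairwise fun i j => Disjoint (wicketArc (a i t0) (b i t0)) (wicketArc (a j t0) (b j t0))) ∧
      (∀ᶠ t in nhds t0, V t = ⋃ i, wicketArc (a i t) (b i t)) := by
  obtain ⟨e, he, hd, hV⟩ := hw t0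
  have hs : ∀ i, ∃ j, (e i).1 = c j t0 := fun i => (hfeet t0 _).mp (by
    rw [hV]; exact Set.mem_iUnion.mpr ⟨i, left_mem _ _⟩)
  have ht : ∀ i, ∃ j, (e i).2 = c j t0 := fun i => (hfeet t0 _).mp (by
    rw [hV]; exact Set.mem_iUnion.mpr ⟨i, right_mem _ _⟩)
  choose σ hσ using hs
  choose τ hτ using ht
  have hne : ∀ i, σ i ≠ τ i := by
    intro i h
    apply (he i).1
    rw [hσ, hτ, h]
  let R : ℝ → Fin n → Fin n → Prop := fun t j k => wicketArc (c j t) (c k t) ⊆ V t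
  -- every pairing at time `t0` comes from some `i`
  have hR0 : ∀ j k, j ≠ k → R t0 j k → ∃ i, (j = σ i ∧ k = τ i) ∨ (j = τ i ∧ k = σ i) := by
    intro j k hjk hR
    have hR' : wicketArc (c j t0) (c k t0) ⊆ ⋃ i, wicketArc (e i).1 (e i).2 := by
      rw [← hV]; exact hR
    obtain ⟨i, hi⟩ := wicket_sub_config (fun i => (he i).1) hd
      (fun h => hjk (hinj t0 j k h)) hR'
    refine ⟨i, ?_⟩
    rw [hσ, hτ] at hi
    rcases hi with ⟨h1, h2⟩ | ⟨h1, h2⟩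
    · exact Or.inl ⟨hinj _ _ _ h1, hinj _ _ _ h2⟩
    · exact Or.inr ⟨hinj _ _ _ h1, hinj _ _ _ h2⟩
  -- feet determine the wicket
  have huniq : ∀ i i', (σ i = σ i' ∨ σ i = τ i') → i = i' := by
    intro i i' h
    by_contra hn
    have hdis := hd hn
    have h1 := left_mem (e i).1 (e i).2
    refine Set.disjoint_left.mp hdis h1 ?_
    rcases h with h | h
    · rw [hσ i, h, ← hσ i']; exact left_mem _ _
    · rw [hσ i, h, ← hτ i']; exact right_mem _ _
  have hclosed : ∀ j k, IsClosed {t | R t j k} := by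
    intro j k
    have : {t | R t j k} = ⋂ θ ∈ Icc 0 Real.pi,
        (fun t => ((wPar (c j t) (c k t) θ, t) : Space3 × ℝ)) ⁻¹' {p : Space3 × ℝ | p.1 ∈ V p.2} := by
      ext t
      simp only [R, wicketArc_eq, Set.mem_iInter, Set.mem_preimage]
      constructor
      · intro h θ hθ
        exact h ⟨θ, hθ, rfl⟩
      · rintro h _ ⟨θ, hθ, rfl⟩
        exact h θ hθ
    rw [this]
    refine isClosed_biInter fun θ _ => hcl.preimage ?_
    refine Continuous.prodMk ?_ continuous_id
    have h1 := hc j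
    have h2 := hc k
    unfold wPar
    fun_prop
  have hev : ∀ᶠ t in nhds t0, ∀ j k, R t j k → R t0 j k := by
    rw [Filter.eventually_all]
    intro j
    rw [Filter.eventually_all]
    intro k
    by_cases h : R t0 j k
    · exact Filter.Eventually.of_forall fun _ _ => h
    · filter_upwards [(hclosed j k).isOpen_compl.mem_nhds h] with t ht hR
      exact absurd hR ht
  refine ⟨fun i => c (σ i), fun i => c (τ i), fun i => hc _, fun i => hc _, ?_, ?_, ?_⟩
  · intro i h
    exact hne i (hinj _ _ _ h)
  · intro i j hij
    have := hd hij
    simp only [hσ, hτ] at this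
    exact this
  · filter_upwards [hev] with t hev
    obtain ⟨e', he', hd', hV'⟩ := hw t
    have hs' : ∀ i, ∃ j, (e' i).1 = c j t := fun i => (hfeet t _).mp (by
      rw [hV']; exact Set.mem_iUnion.mpr ⟨i, left_mem _ _⟩)
    have ht' : ∀ i, ∃ j, (e' i).2 = c j t := fun i => (hfeet t _).mp (by
      rw [hV']; exact Set.mem_iUnion.mpr ⟨i, right_mem _ _⟩)
    choose σ' hσ' using hs'
    choose τ' hτ' using ht'
    have hne' : ∀ i, σ' i ≠ τ' i := by
      intro i h
      apply (he' i).1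
      rw [hσ', hτ', h]
    have hR' : ∀ i, R t (σ' i) (τ' i) := by
      intro i
      simp only [R]
      rw [← hσ', ← hτ', hV']
      exact Set.subset_iUnion (fun i => wicketArc (e' i).1 (e' i).2) i
    apply Set.Subset.antisymm
    · rw [hV']
      refine Set.iUnion_subset fun i' => ?_
      obtain ⟨i, hi⟩ := hR0 _ _ (hne' i') (hev _ _ (hR' i'))
      rw [hσ', hτ']
      refine Set.Subset.trans ?_ (Set.subset_iUnion (fun i => wicketArc (c (σ i) t) (c (τ i) t)) i)
      rcases hi with ⟨h1, h2⟩ | ⟨h1, h2⟩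
      · rw [h1, h2]
      · rw [h1, h2, wicketArc_swap]
    · refine Set.iUnion_subset fun i => ?_
      have hmem : ((c (σ i) t, 0) : Space3) ∈ V t := (hfeet t _).mpr ⟨_, rfl⟩
      rw [hV'] at hmem
      obtain ⟨i', hi'⟩ := Set.mem_iUnion.mp hmem
      obtain ⟨i2, hi2⟩ := hR0 _ _ (hne' i') (hev _ _ (hR' i'))
      have hin := hR' i'
      simp only [R] at hin
      have hfoot := foot_of_mem (he' i').1 hi'
      rw [hσ', hτ'] at hfoot
      have hii : i = i2 := by
        apply huniq
        rcases hfoot with h | h <;> have h := hinj _ _ _ h <;>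
          rcases hi2 with ⟨h1, h2⟩ | ⟨h1, h2⟩ <;> simp [h, h1, h2]
      subst hii
      rcases hi2 with ⟨h1, h2⟩ | ⟨h1, h2⟩
      · rwa [h1, h2] at hin
      · rwa [h1, h2, wicketArc_swap] at hin

/-- The strands of a geometric braid are graphs of continuous functions. -/
theorem strand_cont {s : Set Space3} (hs : IsArc s) (h : ∀ t ∈ unitI, ∃! x : Plane, (x, t) ∈ s)
    (hsub : ∀ p ∈ s, p.2 ∈ unitI) :
    ∃ c : ℝ → Plane, Continuous c ∧ ∀ t ∈ unitI, ∀ x, (x, t) ∈ s ↔ x = c t := by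
  obtain ⟨φ⟩ := hs
  have hI : CompactSpace ↥unitI := isCompact_iff_compactSpace.mp isCompact_Icc
  have hcs : CompactSpace ↥s := φ.symm.compactSpace
  let f : ↥s → ↥unitI := fun p => ⟨(p : Space3).2, hsub _ p.2⟩
  have hf : Continuous f := by
    refine Continuous.subtype_mk ?_ _
    exact continuous_snd.comp continuous_subtype_val
  have hbij : Function.Bijective f := by
    constructor
    · rintro ⟨⟨x, t⟩, hx⟩ ⟨⟨y, u⟩, hy⟩ hxy
      have htu : t = u := congrArg Subtype.val hxy
      subst htu
      have := (h t (hsub _ hx)).unique hx hy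
      subst this
      rfl
    · rintro ⟨t, ht⟩
      obtain ⟨x, hx, -⟩ := h t ht
      exact ⟨⟨(x, t), hx⟩, rfl⟩
  let F : ↥s ≃ₜ ↥unitI :=
    Continuous.homeoOfEquivCompactToT2 (f := Equiv.ofBijective f hbij) hf
  have hF : ∀ p, F p = f p := fun p => rfl
  have h01 : (0:ℝ) ≤ 1 := zero_le_one
  refine ⟨fun t => ((F.symm (Set.projIcc 0 1 h01 t) : ↥s) : Space3).1, ?_, ?_⟩
  · have : Continuous fun t => F.symm (Set.projIcc 0 1 h01 t) :=
      F.symm.continuous.comp continuous_projIcc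
    exact continuous_fst.comp (continuous_subtype_val.comp this)
  · intro t ht x
    have e1 : Set.projIcc 0 1 h01 t = ⟨t, ht⟩ := Set.projIcc_of_mem h01 ht
    have e2 : ((F.symm (Set.projIcc 0 1 h01 t) : ↥s) : Space3).2 = t := by
      rw [e1]
      have : f (F.symm ⟨t, ht⟩) = ⟨t, ht⟩ := by rw [← hF, F.apply_symm_apply]
      exact congrArg Subtype.val this
    have e3 : (((F.symm (Set.projIcc 0 1 h01 t) : ↥s) : Space3).1, t) ∈ s := by
      have key : ∀ p : Space3, p ∈ s → p.2 = t → (p.1, t) ∈ s := by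
        rintro p hp rfl; exact hp
      exact key _ (F.symm (Set.projIcc 0 1 h01 t)).2 e2
    constructor
    · intro hx
      exact (h t ht).unique hx e3
    · rintro rfl
      exact e3


/-- Stacking an isotopy of the half space on top of its trace on the boundary plane. -/
def Gmap (Φ : ℝ → Space3 → Space3) (u : ℝ) (p : Space3) : Space3 :=
  ((Φ (u * max 0 (min 1 p.2)) (p.1, max (p.2 - 1) 0)).1,
    (Φ (u * max 0 (min 1 p.2)) (p.1, max (p.2 - 1) 0)).2 + min p.2 1)

theorem Gmap_cont {Φ : ℝ → Space3 → Space3}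
    (h : Continuous (fun p : ℝ × Space3 => Φ p.1 p.2)) :
    Continuous (fun p : ℝ × Space3 => Gmap Φ p.1 p.2) := by
  have h1 : Continuous (fun p : ℝ × Space3 =>
      Φ (p.1 * max 0 (min 1 p.2.2)) (p.2.1, max (p.2.2 - 1) 0)) := by
    have h2 : Continuous (fun p : ℝ × Space3 =>
      ((p.1 * max 0 (min 1 p.2.2), (p.2.1, max (p.2.2 - 1) 0)) : ℝ × Space3)) := by fun_prop
    exact h.comp h2
  unfold Gmap
  fun_prop

theorem Gmap_low {Φ : ℝ → Space3 → Space3} (hp : ∀ t, HP (Φ t)) (u : ℝ) (x : Plane) (h : ℝ)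
    (hh : h ≤ 1) : Gmap Φ u (x, h) = ((Φ (u * max 0 h) (x, 0)).1, h) := by
  have e1 : max (h - 1) 0 = 0 := max_eq_right (by linarith)
  simp only [Gmap, e1, min_eq_left hh, min_eq_right hh]
  have := (((hp (u * max 0 h)) (x, 0)).1).mpr rfl
  rw [this, zero_add]

theorem Gmap_high {Φ : ℝ → Space3 → Space3} (u : ℝ) (x : Plane) (h : ℝ)
    (hh : 1 ≤ h) : Gmap Φ u (x, h) = ((Φ u (x, h - 1)).1, (Φ u (x, h - 1)).2 + 1) := by
  have e1 : max (h - 1) 0 = h - 1 := max_eq_left (by linarith)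
  have e2 : max (0:ℝ) 1 = 1 := max_eq_right zero_le_one
  simp only [Gmap, e1, min_eq_left hh, min_eq_right hh, e2, mul_one]

theorem HP.nonneg {f : Space3 → Space3} (hf : HP f) {x : Space3} (hx : 0 ≤ x.2) :
    0 ≤ (f x).2 := by
  rcases hx.eq_or_lt with h | h
  · exact ((hf x).1.mpr h.symm).ge
  · exact ((hf x).2.mpr h).le

theorem Gmap_inv {Φ Ψ : ℝ → Space3 → Space3} (hp : ∀ t, HP (Φ t)) (hp' : ∀ t, HP (Ψ t))
    (hinv : ∀ t x, Ψ t (Φ t x) = x) (u : ℝ) (p : Space3) : Gmap Ψ u (Gmap Φ u p) = p := by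
  obtain ⟨x, h⟩ := p
  rcases le_total h 1 with hh | hh
  · rw [Gmap_low hp u x h hh, Gmap_low hp' u _ h hh]
    have e : (((Φ (u * max 0 h) (x, 0)).1, 0) : Space3) = Φ (u * max 0 h) (x, 0) :=
      Prod.ext rfl ((((hp (u * max 0 h)) (x, 0)).1).mpr rfl).symm
    rw [e, hinv]
  · rw [Gmap_high u x h hh]
    have hn : 0 ≤ (Φ u (x, h - 1)).2 := (hp u).nonneg (by simpa using hh)
    rw [Gmap_high u _ _ (by linarith), add_sub_cancel_right]
    change ((Ψ u (Φ u (x, h - 1))).1, (Ψ u (Φ u (x, h - 1))).2 + 1) = _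
    rw [hinv]
    simp

theorem std_nonneg {m : ℕ} {p : Space3} (hp : p ∈ stdWickets m) : 0 ≤ p.2 := by
  obtain ⟨i, hi⟩ := Set.mem_iUnion.mp hp
  exact wicketArc_nonneg hi

theorem plat_isotopic (m : ℕ) (β : Set Space3) (hβ : IsAdequateBraid m β) :
    AmbientIsotopic (platClosure3 m β) (platClosure3 m (trivBraid (2*m))) := by
  obtain ⟨W, hWc, hWI, hWw, hW0, hW1, hWβ⟩ := hβ.lift
  obtain ⟨s, hsarc, hsd, hsβ, hsu⟩ := hβ.braid.strands
  have hsub : ∀ i, ∀ p ∈ s i, p.2 ∈ unitI := fun i p hp =>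
    (hβ.braid.sub (by rw [hsβ]; exact Set.mem_iUnion.mpr ⟨i, hp⟩)).2
  have hstr := fun i => strand_cont (hsarc i) (hsu i) (hsub i)
  choose c hc hcs using hstr
  let cl : ℝ → ℝ := fun t => max 0 (min 1 t)
  have hcl : ∀ t, cl t ∈ unitI := fun t => ⟨le_max_left _ _, max_le zero_le_one (min_le_left _ _)⟩
  have hcle : ∀ t ∈ unitI, cl t = t := by
    intro t ht
    simp only [cl]
    rw [min_eq_right ht.2, max_eq_right ht.1]
  have hclc : Continuous cl := by fun_prop
  let V : ℝ → Set Space3 := fun t => {q | (q, cl t) ∈ W}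
  have hV0 : V 0 = stdWickets m := by
    rw [← hW0]
    have : cl 0 = 0 := hcle 0 ⟨le_rfl, zero_le_one⟩
    simp only [V, this]
  have hV1 : V 1 = stdWickets m := by
    rw [← hW1]
    have : cl 1 = 1 := hcle 1 ⟨zero_le_one, le_rfl⟩
    simp only [V, this]
  have hfeetβ : ∀ t ∈ unitI, ∀ x : Plane, ((x, 0) : Space3) ∈ V t ↔ (x, t) ∈ β := by
    intro t ht x
    rw [← hWβ t ht x]
    simp only [V, hcle t ht]
    rfl
  obtain ⟨Φ, hΦ, hΦ0, hΦV⟩ := isotopy_extension m V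
    (by
      intro t ht
      have e1 : cl t = 0 := by
        simp only [cl]
        exact max_eq_left ((min_le_right _ _).trans ht)
      have e2 : cl 0 = 0 := hcle 0 ⟨le_rfl, zero_le_one⟩
      simp only [V, e1, e2])
    (local_wickets m (2*m) V
      (by
        have : {p : Space3 × ℝ | p.1 ∈ V p.2} = (fun p : Space3 × ℝ => (p.1, cl p.2)) ⁻¹' W := rfl
        rw [this]
        exact hWc.isClosed.preimage (by fun_prop))
      (fun t => hWw (cl t) (hcl t))
      (fun j t => c j (cl t)) (fun j => (hc j).comp hclc)
      (by
        intro t j k hjk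
        by_contra hn
        have h1 := (hcs j (cl t) (hcl t) (c j (cl t))).mpr rfl
        have h2 := (hcs k (cl t) (hcl t) (c j (cl t))).mpr hjk
        exact Set.disjoint_left.mp (hsd hn) h1 h2)
      (by
        intro t x
        have : ((x, 0) : Space3) ∈ V t ↔ (x, cl t) ∈ β := hWβ (cl t) (hcl t) x
        rw [this, hsβ, Set.mem_iUnion]
        exact exists_congr fun j => hcs j (cl t) (hcl t) x))
  have hps : ∀ t, HP (Φ t).symm := fun t => (hΦ.hp t).symm
  let f : ℝ → Space3 → Space3 := fun t => Φ t
  let g : ℝ → Space3 → Space3 := fun t => (Φ t).symm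
  have hfg : ∀ u p, Gmap f u (Gmap g u p) = p :=
    Gmap_inv hps hΦ.hp (fun t x => (Φ t).apply_symm_apply x)
  have hgf : ∀ u p, Gmap g u (Gmap f u p) = p :=
    Gmap_inv hΦ.hp hps (fun t x => (Φ t).symm_apply_apply x)
  have cf := Gmap_cont (Φ := f) hΦ.cont
  have cg := Gmap_cont (Φ := g) hΦ.conts
  have hmem : ∀ t ≤ 1, ∀ q, Φ t q ∈ V t ↔ q ∈ V 0 := by
    intro t ht q
    rw [← hΦV t ht]
    exact (Φ t).injective.mem_set_image
  -- the trivial braid at each level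
  have htriv : ∀ t ∈ unitI, ∀ x : Plane,
      ((x, t) : Space3) ∈ trivBraid (2*m) ↔ ((x, 0) : Space3) ∈ V 0 := by
    intro t ht x
    rw [hfeetβ 0 ⟨le_rfl, zero_le_one⟩]
    have h1 := hβ.braid.bot
    have h2 : (x, (0:ℝ)) ∈ β ↔ x ∈ slice3 β 0 := Iff.rfl
    rw [h2, h1]
    constructor
    · rintro ⟨k, hk, -⟩; exact ⟨k, hk⟩
    · rintro ⟨k, hk⟩; exact ⟨k, hk, ht⟩
  have hβI : ∀ x t, ((x, t) : Space3) ∈ β → t ∈ unitI := fun x t h => (hβ.braid.sub h).2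
  have htI : ∀ x t, ((x, t) : Space3) ∈ trivBraid (2*m) → t ∈ unitI := by
    rintro x t ⟨k, -, h⟩; exact h
  have mem_pc : ∀ (γ : Set Space3) x h, ((x, h) : Space3) ∈ platClosure3 m γ ↔
      (((x, h) : Space3) ∈ γ ∨ ((x, -h) : Space3) ∈ stdWickets m) ∨
        ((x, h - 1) : Space3) ∈ stdWickets m := fun γ x h => Iff.rfl
  -- levels of plat closures
  have pc_low : ∀ (γ : Set Space3), (∀ x t, ((x, t) : Space3) ∈ γ → t ∈ unitI) →
      ∀ x h, h < 0 → (((x, h) : Space3) ∈ platClosure3 m γ ↔ ((x, -h) : Space3) ∈ stdWickets m) := by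
    intro γ hγ x h hh
    rw [mem_pc]
    constructor
    · rintro ((h1 | h1) | h1)
      · exact absurd (hγ _ _ h1).1 (by linarith)
      · exact h1
      · have := std_nonneg h1
        simp only at this
        linarith
    · intro h1; exact Or.inl (Or.inr h1)
  have pc_mid : ∀ (γ : Set Space3), (∀ x, ((x, 0) : Space3) ∈ γ ↔ ((x, 0) : Space3) ∈ stdWickets m) →
      (∀ x, ((x, 1) : Space3) ∈ γ ↔ ((x, 0) : Space3) ∈ stdWickets m) →
      ∀ x, ∀ h ∈ unitI, (((x, h) : Space3) ∈ platClosure3 m γ ↔ ((x, h) : Space3) ∈ γ) := by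
    intro γ h0 h1 x h hh
    rw [mem_pc]
    constructor
    · rintro ((h2 | h2) | h2)
      · exact h2
      · have := std_nonneg h2
        simp only at this
        have e : h = 0 := le_antisymm (by linarith) hh.1
        subst e
        rw [neg_zero] at h2
        exact (h0 x).mpr h2
      · have := std_nonneg h2
        simp only at this
        have e : h = 1 := le_antisymm hh.2 (by linarith)
        subst e
        rw [sub_self] at h2
        exact (h1 x).mpr h2
    · intro h2; exact Or.inl (Or.inl h2)
  have pc_high : ∀ (γ : Set Space3), (∀ x t, ((x, t) : Space3) ∈ γ → t ∈ unitI) →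
      (∀ x, ((x, 1) : Space3) ∈ γ ↔ ((x, 0) : Space3) ∈ stdWickets m) →
      ∀ x h, 1 ≤ h →
        (((x, h) : Space3) ∈ platClosure3 m γ ↔ ((x, h - 1) : Space3) ∈ stdWickets m) := by
    intro γ hγ h1 x h hh
    rw [mem_pc]
    constructor
    · rintro ((h2 | h2) | h2)
      · have e : h = 1 := le_antisymm (hγ _ _ h2).2 hh
        subst e
        rw [sub_self]
        exact (h1 x).mp h2
      · have := std_nonneg h2
        simp only at this
        linarith
      · exact h2
    · intro h2; exact Or.inr h2
  have z0 : (0:ℝ) ∈ unitI := ⟨le_rfl, zero_le_one⟩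
  have z1 : (1:ℝ) ∈ unitI := ⟨zero_le_one, le_rfl⟩
  have b0 : ∀ x, ((x, 0) : Space3) ∈ β ↔ ((x, 0) : Space3) ∈ stdWickets m := fun x => by
    rw [← hfeetβ 0 z0, hV0]
  have b1 : ∀ x, ((x, 1) : Space3) ∈ β ↔ ((x, 0) : Space3) ∈ stdWickets m := fun x => by
    rw [← hfeetβ 1 z1, hV1]
  have t0 : ∀ x, ((x, 0) : Space3) ∈ trivBraid (2*m) ↔ ((x, 0) : Space3) ∈ stdWickets m :=
    fun x => by rw [htriv 0 z0, hV0]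
  have t1 : ∀ x, ((x, 1) : Space3) ∈ trivBraid (2*m) ↔ ((x, 0) : Space3) ∈ stdWickets m :=
    fun x => by rw [htriv 1 z1, hV0]
  have main : ∀ p, Gmap f 1 p ∈ platClosure3 m β ↔ p ∈ platClosure3 m (trivBraid (2*m)) := by
    rintro ⟨x, h⟩
    rcases lt_or_ge h 0 with hh | hh
    · rw [Gmap_low hΦ.hp 1 x h (by linarith), max_eq_left hh.le, mul_zero]
      have : Φ 0 (x, 0) = (x, 0) := by rw [hΦ0]; rfl
      rw [this, pc_low β hβI x h hh, pc_low _ htI x h hh]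
    · rcases le_total h 1 with hh1 | hh1
      · rw [Gmap_low hΦ.hp 1 x h hh1, max_eq_right hh, one_mul,
          pc_mid β b0 b1 _ h ⟨hh, hh1⟩, pc_mid _ t0 t1 _ h ⟨hh, hh1⟩, htriv h ⟨hh, hh1⟩,
          ← hfeetβ h ⟨hh, hh1⟩, ← hmem h hh1 (x, 0)]
        have e : (((Φ h (x, 0)).1, 0) : Space3) = Φ h (x, 0) :=
          Prod.ext rfl ((((hΦ.hp h) (x, 0)).1).mpr rfl).symm
        rw [e]
      · rw [Gmap_high 1 x h hh1]
        have hn : 0 ≤ (f 1 (x, h - 1)).2 := (hΦ.hp 1).nonneg (by simpa using hh1)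
        rw [pc_high β hβI b1 _ _ (by linarith), pc_high _ htI t1 _ _ hh1, add_sub_cancel_right]
        have e := hmem 1 le_rfl (x, h - 1)
        rw [hV1, hV0] at e
        exact e
  refine ⟨fun u => ⟨⟨Gmap g u, Gmap f u, hfg u, hgf u⟩, ?_, ?_⟩, cg, cf, ?_, ?_⟩
  · exact cg.comp (continuous_const.prodMk continuous_id)
  · exact cf.comp (continuous_const.prodMk continuous_id)
  · ext1 p
    change Gmap g 0 p = p
    have : Gmap f 0 p = p := by
      have hf0 : ∀ x, f 0 x = x := by
        intro x
        simp only [f, hΦ0]; rfl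
      simp only [Gmap, zero_mul, hf0]
      refine Prod.ext rfl ?_
      change max (p.2 - 1) 0 + min p.2 1 = p.2
      rcases le_total p.2 1 with h | h
      · rw [max_eq_right (by linarith), min_eq_left h]; ring
      · rw [max_eq_left (by linarith), min_eq_right h]; ring
    have h2 := hgf 0 p
    rwa [this] at h2
  · apply Set.Subset.antisymm
    · rintro _ ⟨p, hp, rfl⟩
      change Gmap g 1 p ∈ _
      rw [← main, hfg]
      exact hp
    · intro p hp
      exact ⟨Gmap f 1 p, (main p).mpr hp, hgf 1 p⟩


/-- Distance of a height to the unit interval. -/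
def hgap (h : ℝ) : ℝ := |h - 1/2| - min |h - 1/2| (1/2)

theorem hgap_mid {h : ℝ} (h0 : 0 ≤ h) (h1 : h ≤ 1) : hgap h = 0 := by
  have : |h - 1/2| ≤ 1/2 := by rw [abs_le]; constructor <;> linarith
  rw [hgap, min_eq_left this, sub_self]

theorem hgap_low {h : ℝ} (h0 : h ≤ 0) : hgap h = -h := by
  have : |h - 1/2| = 1/2 - h := by rw [abs_of_nonpos (by linarith)]; ring
  rw [hgap, this, min_eq_right (by linarith)]; ring

theorem hgap_high {h : ℝ} (h0 : 1 ≤ h) : hgap h = h - 1 := by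
  have : |h - 1/2| = h - 1/2 := by rw [abs_of_nonneg (by linarith)]
  rw [hgap, this, min_eq_right (by linarith)]; ring

/-- Horizontal squeezing factor turning a round disk into a stadium. -/
def sqz (r h : ℝ) : ℝ :=
  Real.sqrt (r * (r + hgap h) /
    ((r + 1/2 - min |h - 1/2| (1/2)) * (r + 1/2 + |h - 1/2|)))

theorem hgap_nonneg (h : ℝ) : 0 ≤ hgap h := sub_nonneg.mpr (min_le_left _ _)

theorem sqz_den {r : ℝ} (hr : 0 < r) (h : ℝ) :
    0 < (r + 1/2 - min |h - 1/2| (1/2)) * (r + 1/2 + |h - 1/2|) := by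
  have h1 : min |h - 1/2| (1/2) ≤ 1/2 := min_le_right _ _
  have h2 := abs_nonneg (h - 1/2)
  exact mul_pos (by linarith) (by linarith)

theorem sqz_pos {r : ℝ} (hr : 0 < r) (h : ℝ) : 0 < sqz r h := by
  apply Real.sqrt_pos.mpr
  exact div_pos (mul_pos hr (by linarith [hgap_nonneg h])) (sqz_den hr h)

theorem sqz_cont {r : ℝ} (hr : 0 < r) : Continuous (sqz r) := by
  unfold sqz
  refine Continuous.sqrt (Continuous.div ?_ ?_ fun h => (sqz_den hr h).ne')
  · unfold hgap; fun_prop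
  · fun_prop

theorem sqz_eq {r : ℝ} (hr : 0 < r) (h : ℝ) :
    ((r + 1/2)^2 - (h - 1/2)^2) * (sqz r h)^2 = r^2 - (hgap h)^2 := by
  have hn : 0 ≤ r * (r + hgap h) /
    ((r + 1/2 - min |h - 1/2| (1/2)) * (r + 1/2 + |h - 1/2|)) :=
    (div_pos (mul_pos hr (by linarith [hgap_nonneg h])) (sqz_den hr h)).le
  rw [sqz, Real.sq_sqrt hn, mul_div_assoc', div_eq_iff (sqz_den hr h).ne', ← sq_abs (h - 1/2)]
  unfold hgap
  generalize |h - 1/2| = a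
  rcases le_total a (1/2) with ha | ha
  · rw [min_eq_left ha]; ring
  · rw [min_eq_right ha]; ring

theorem vertical_wicket {x y z : ℝ} (p : Space3) (r c : ℝ) (hr : 0 < r) (hy : y = c - r)
    (hz : z = c + r) :
    p ∈ wicketArc (x, y) (x, z) ↔
      p.1.1 = x ∧ (p.1.2 - c)^2 + p.2^2 = r^2 ∧ 0 ≤ p.2 := by
  have hrad : Real.sqrt (((x - x)/2)^2 + ((y - z)/2)^2) = r := by
    have : ((x - x)/2)^2 + ((y - z)/2)^2 = r^2 := by rw [hy, hz]; ring
    rw [this, Real.sqrt_sq hr.le]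
  constructor
  · intro hp
    have hnn := wicketArc_nonneg hp
    rw [wicketArc_eq] at hp
    obtain ⟨θ, hθ, rfl⟩ := hp
    refine ⟨?_, ?_, hnn⟩
    · simp [wPar]; ring
    · simp only [wPar, hrad, Prod.snd_add, Prod.smul_snd, Prod.snd_sub, smul_eq_mul]
      rw [hy, hz]
      have := Real.sin_sq_add_cos_sq θ
      have e : (1/2 * (c - r + (c + r)) + Real.cos θ * (1/2 * (c - r - (c + r))) - c)^2
        + (r * Real.sin θ)^2 = r^2 * (Real.sin θ^2 + Real.cos θ^2) := by ring
      rw [e, this, mul_one]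
  · rintro ⟨h1, h2, h3⟩
    rw [wicketArc_eq]
    have hle : |(c - p.1.2) / r| ≤ 1 := by
      rw [abs_div, abs_of_pos hr, div_le_one hr]
      apply abs_le_of_sq_le_sq _ hr.le
      nlinarith [sq_nonneg p.2]
    rw [abs_le] at hle
    refine ⟨Real.arccos ((c - p.1.2) / r), ⟨Real.arccos_nonneg _, Real.arccos_le_pi _⟩, ?_⟩
    have hsin : r * Real.sin (Real.arccos ((c - p.1.2) / r)) = p.2 := by
      rw [Real.sin_arccos]
      have e : 1 - ((c - p.1.2) / r)^2 = (p.2 / r)^2 := by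
        field_simp
        linarith
      rw [e, Real.sqrt_sq (div_nonneg h3 hr.le)]
      field_simp
    have hcos := Real.cos_arccos hle.1 hle.2
    refine Prod.ext (Prod.ext ?_ ?_) ?_
    · simp [wPar, h1]; ring
    · simp only [wPar, hcos, Prod.snd_add, Prod.smul_snd, Prod.snd_sub, smul_eq_mul]
      rw [hy, hz]
      field_simp
      ring
    · simp only [wPar, hrad]
      exact hsin

/-- The stadium-shaped disk. -/
def stad (r c : ℝ) (p : Plane) : Space3 :=
  ((1/2, c + (r + 1/2) * p.1 * sqz r (1/2 + (r + 1/2) * p.2)), 1/2 + (r + 1/2) * p.2)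

theorem stad_cont {r : ℝ} (hr : 0 < r) (c : ℝ) : Continuous (stad r c) := by
  have h := sqz_cont hr
  unfold stad
  fun_prop

theorem stad_inj {r : ℝ} (hr : 0 < r) (c : ℝ) : Function.Injective (stad r c) := by
  rintro ⟨u, v⟩ ⟨u', v'⟩ h
  have hR : r + 1/2 ≠ 0 := by positivity
  have h2 := congrArg Prod.snd h
  simp only [stad] at h2
  have hv : v = v' := mul_left_cancel₀ hR (add_left_cancel h2)
  subst hv
  have h1 := congrArg (fun q : Space3 => q.1.2) h
  simp only [stad] at h1
  have h3 := mul_right_cancel₀ (sqz_pos hr _).ne' (add_left_cancel h1)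
  rw [mul_left_cancel₀ hR h3]

theorem stad_width {r : ℝ} (hr : 0 < r) (c : ℝ) (p : Plane) (hp : p ∈ unitDisk) :
    |(stad r c p).1.2 - c| ≤ r := by
  apply abs_le_of_sq_le_sq _ hr.le
  have h := sqz_eq hr (1/2 + (r + 1/2) * p.2)
  have hp' : p.1^2 + p.2^2 ≤ 1 := hp
  simp only [stad]
  set s := sqz r (1/2 + (r + 1/2) * p.2)
  have e : (c + (r + 1/2) * p.1 * s - c)^2 = ((r+1/2)*s)^2 * p.1^2 := by ring
  rw [e]
  have e2 : ((r + 1/2)^2 - (1/2 + (r + 1/2) * p.2 - 1/2)^2) * s^2 =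
    ((r+1/2)*s)^2 * (1 - p.2^2) := by ring
  rw [e2] at h
  have : ((r+1/2)*s)^2 * p.1^2 ≤ ((r+1/2)*s)^2 * (1 - p.2^2) :=
    mul_le_mul_of_nonneg_left (by linarith) (sq_nonneg _)
  nlinarith [sq_nonneg (hgap (1/2 + (r + 1/2) * p.2))]

theorem stad_circle {r : ℝ} (hr : 0 < r) (c : ℝ) :
    stad r c '' unitCircle = {p : Space3 | p.1.1 = 1/2 ∧ (p.1.2 - c)^2 + (hgap p.2)^2 = r^2} := by
  have hR : r + 1/2 ≠ 0 := by positivity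
  apply Set.Subset.antisymm
  · rintro _ ⟨p, hp, rfl⟩
    refine ⟨rfl, ?_⟩
    have hp' : p.1^2 + p.2^2 = 1 := hp
    have h := sqz_eq hr (1/2 + (r + 1/2) * p.2)
    simp only [stad]
    have e : 1 - p.2^2 = p.1^2 := by linarith
    have e2 : ((r + 1/2)^2 - (1/2 + (r + 1/2) * p.2 - 1/2)^2) = (r+1/2)^2 * (1 - p.2^2) := by ring
    rw [e2, e] at h
    linear_combination h
  · rintro ⟨⟨x, y⟩, h⟩ ⟨h1, h2⟩
    simp only at h1 h2
    subst h1
    have hs := sqz_pos hr h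
    have he := sqz_eq hr h
    have hv : 1/2 + (r + 1/2) * ((h - 1/2) / (r + 1/2)) = h := by field_simp; ring
    refine ⟨((y - c) / ((r + 1/2) * sqz r h), (h - 1/2) / (r + 1/2)), ?_, ?_⟩
    · change ((y - c) / ((r + 1/2) * sqz r h))^2 + ((h - 1/2) / (r + 1/2))^2 = 1
      rw [div_pow, div_pow, mul_pow, div_add_div _ _ (by positivity) (by positivity),
        div_eq_one_iff_eq (by positivity)]
      linear_combination (r + 1/2)^2 * h2 - (r+1/2)^2 * he
    · simp only [stad, hv]
      refine Prod.ext (Prod.ext rfl ?_) rfl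
      simp only
      field_simp
      ring

theorem triv_trivial (m : ℕ) : IsTrivialLinkOf m (platClosure3 m (trivBraid (2*m))) := by
  set N : ℝ := 2 * (m:ℝ) + 1 with hN
  have hNp : 0 < N := by positivity
  set r : ℝ := 1 / (2 * N) with hrdef
  have hr : 0 < r := by positivity
  let c : Fin m → ℝ := fun i => (4 * ((i:ℕ):ℝ) + 3) * r
  have hq0 : ∀ i : Fin m, qpt (2*m) (2*(i:ℕ)) = (1/2, c i - r) := by
    intro i
    refine Prod.ext rfl ?_
    simp only [qpt, c, hrdef, hN]
    push_cast
    field_simp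
    ring
  have hq1 : ∀ i : Fin m, qpt (2*m) (2*(i:ℕ)+1) = (1/2, c i + r) := by
    intro i
    refine Prod.ext rfl ?_
    simp only [qpt, c, hrdef, hN]
    push_cast
    field_simp
    ring
  have hstd : ∀ p : Space3, p ∈ stdWickets m ↔
      ∃ i, p.1.1 = 1/2 ∧ (p.1.2 - c i)^2 + p.2^2 = r^2 ∧ 0 ≤ p.2 := by
    intro p
    rw [stdWickets, Set.mem_iUnion]
    refine exists_congr fun i => ?_
    rw [hq0, hq1]
    exact vertical_wicket p r (c i) hr rfl rfl
  have htriv : ∀ p : Space3, p ∈ trivBraid (2*m) ↔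
      ∃ i, p.1.1 = 1/2 ∧ (p.1.2 - c i)^2 = r^2 ∧ p.2 ∈ unitI := by
    intro p
    constructor
    · rintro ⟨k, hk, hp⟩
      have hlt : (k:ℕ)/2 < m := by have := k.2; omega
      obtain ⟨i, hi⟩ : ∃ i : Fin m, (i:ℕ) = (k:ℕ)/2 := ⟨⟨(k:ℕ)/2, hlt⟩, rfl⟩
      refine ⟨i, ?_, ?_, hp⟩
      · rw [hk]; rfl
      · rcases Nat.even_or_odd' (k:ℕ) with ⟨j, hj | hj⟩
        · have e : (k:ℕ) = 2 * (i:ℕ) := by omega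
          rw [hk, e, hq0]
          ring_nf
        · have e : (k:ℕ) = 2 * (i:ℕ) + 1 := by omega
          rw [hk, e, hq1]
          ring_nf
    · rintro ⟨i, h1, h2, h3⟩
      rcases sq_eq_sq_iff_eq_or_eq_neg.mp h2 with h | h
      · refine ⟨⟨2*(i:ℕ)+1, by have := i.2; omega⟩, ?_, h3⟩
        simp only
        rw [hq1]
        exact Prod.ext h1 (by simp only; linarith)
      · refine ⟨⟨2*(i:ℕ), by have := i.2; omega⟩, ?_, h3⟩
        simp only
        rw [hq0]
        exact Prod.ext h1 (by simp only; linarith)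
  refine ⟨fun i => stad r (c i), fun i => ⟨stad_cont hr _, (stad_inj hr _).injOn⟩, ?_, ?_⟩
  · intro i j hij
    rw [Set.disjoint_left]
    rintro _ ⟨p, hp, rfl⟩ ⟨q, hq, hqp⟩
    have w1 := stad_width hr (c i) p hp
    have w2 := stad_width hr (c j) q hq
    change stad r (c j) q = stad r (c i) p at hqp
    rw [hqp] at w2
    rw [abs_le] at w1 w2
    have hne : (i:ℕ) ≠ (j:ℕ) := fun h => hij (Fin.ext h)
    simp only [c] at w1 w2
    rcases lt_or_gt_of_ne hne with h | h
    · have h' : ((i:ℕ):ℝ) + 1 ≤ ((j:ℕ):ℝ) := by exact_mod_cast h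
      nlinarith
    · have h' : ((j:ℕ):ℝ) + 1 ≤ ((i:ℕ):ℝ) := by exact_mod_cast h
      nlinarith
  · ext p
    simp only [stad_circle hr, Set.mem_iUnion]
    have hmem : p ∈ platClosure3 m (trivBraid (2*m)) ↔
        (p ∈ trivBraid (2*m) ∨ ((p.1, -p.2) : Space3) ∈ stdWickets m) ∨
        ((p.1, p.2 - 1) : Space3) ∈ stdWickets m := Iff.rfl
    rw [hmem, htriv, hstd, hstd]
    constructor
    · rintro ((⟨i, h1, h2, h3⟩ | ⟨i, h1, h2, h3⟩) | ⟨i, h1, h2, h3⟩)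
      · refine ⟨i, h1, ?_⟩
        rw [hgap_mid h3.1 h3.2, h2]; ring
      · refine ⟨i, h1, ?_⟩
        simp only at h3 h2
        rw [hgap_low (by linarith)]; exact h2
      · refine ⟨i, h1, ?_⟩
        simp only at h3 h2
        rw [hgap_high (by linarith)]; exact h2
    · rintro ⟨i, h1, h2⟩
      rcases le_total p.2 0 with h | h
      · rw [hgap_low h] at h2
        exact Or.inl (Or.inr ⟨i, h1, h2, by simpa using h⟩)
      · rcases le_total p.2 1 with h' | h'
        · rw [hgap_mid h h'] at h2
          exact Or.inl (Or.inl ⟨i, h1, by simpa using h2, ⟨h, h'⟩⟩)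
        · rw [hgap_high h'] at h2
          exact Or.inr ⟨i, h1, h2, by simpa using h'⟩

theorem trivial_of_isotopic {m : ℕ} {L L' : Set Space3} (h : AmbientIsotopic L L')
    (h' : IsTrivialLinkOf m L') : IsTrivialLinkOf m L := by
  obtain ⟨H, -, -, -, hH⟩ := h
  obtain ⟨φ, h1, h2, h3⟩ := h'
  have hL : L = (H 1).symm '' L' := by
    rw [← hH, Set.image_image]; simp
  refine ⟨fun i x => (H 1).symm (φ i x), fun i => ⟨(H 1).symm.continuous.comp (h1 i).1, ?_⟩, ?_, ?_⟩
  · exact (H 1).symm.injective.comp_injOn (h1 i).2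
  · intro i j hij
    have := (Set.disjoint_image_iff (H 1).symm.injective).mpr (h2 hij)
    rwa [Set.image_image, Set.image_image] at this
  · rw [hL, h3, Set.image_iUnion]
    refine Set.iUnion_congr fun i => ?_
    rw [Set.image_image]


/-- The plat closure of an adequate `2m`-braid is ambiently isotopic to the plat closure
of the trivial `2m`-braid and is a trivial link with `m` components in `ℝ³`. -/
theorem plat_closure_of_adequate_braid_is_trivial_link (m : ℕ) (hm : 0 < m)
    (β : Set Space3) (hβ : IsAdequateBraid m β) :
    AmbientIsotopic (platClosure3 m β) (platClosure3 m (trivBraid (2*m))) ∧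
    IsTrivialLinkOf m (platClosure3 m β) := by
  have h := plat_isotopic m β hβ
  exact ⟨h, trivial_of_isotopic h (triv_trivial m)⟩

end

end SurfaceLinkPlat
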